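/- arXiv:2201.04776 — 2 statements merged into one kernel-verified Lean document; each statement's English description precedes it below -/
import Mathlib

section
/- For every positive integer m, min B_2^{(1)}(m) = min B_2^{(2)}(m) = q_f(m). -/
/-- A sequence of digits has a last nonzero digit. -/
def hasLastNonzero (c : ℕ → ℕ) : Prop := ∃ n, c n ≠ 0 ∧ ∀ i > n, c i = 0

/-- `c` (with `c i` the `(i+1)`-st digit) is a `q`-expansion of `x`
with respect to the digit set `Ω_m = {0,1,…,m}`. -/
def isExpansion (m : ℕ) (q : ℝ) (x : ℝ) (c : ℕ → ℕ) : Prop :=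
  (∀ i, c i ≤ m) ∧ x = ∑' i : ℕ, (c i : ℝ) / q ^ (i + 1)

/-- The set `U_q` of points of `I_q = [0, m/(q-1)]` with a unique `q`-expansion. -/
def Uq (m : ℕ) (q : ℝ) : Set ℝ :=
  {x | x ∈ Set.Icc 0 ((m : ℝ) / (q - 1)) ∧ ∃! c, isExpansion m q x c}

/-- The set `U'_q` of digit sequences that are unique `q`-expansions. -/
def Uq' (m : ℕ) (q : ℝ) : Set (ℕ → ℕ) :=
  {c | isExpansion m q (∑' i : ℕ, (c i : ℝ) / q ^ (i + 1)) c ∧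
       ∀ d, isExpansion m q (∑' i : ℕ, (c i : ℝ) / q ^ (i + 1)) d → d = c}

/-- `B_2(m)`: bases `q ∈ (1, m+1]` for which some `x ∈ I_q` has exactly two
different `q`-expansions. -/
def B2 (m : ℕ) : Set ℝ :=
  {q | q ∈ Set.Ioc 1 ((m : ℝ) + 1) ∧
    ∃ x ∈ Set.Icc (0 : ℝ) ((m : ℝ) / (q - 1)), ∃ a b : ℕ → ℕ,
      a ≠ b ∧ isExpansion m q x a ∧ isExpansion m q x b ∧
      ∀ c, isExpansion m q x c → c = a ∨ c = b}

/-- Strict lexicographic order on digit sequences. -/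
def lexLt (a b : ℕ → ℕ) : Prop := ∃ n, (∀ i < n, a i = b i) ∧ a n < b n

/-- Lexicographic order on digit sequences. -/
def lexLe (a b : ℕ → ℕ) : Prop := lexLt a b ∨ a = b

/-- `a` is the quasi-greedy `q`-expansion of `1`: the lexicographically largest
`q`-expansion of `1` without a last nonzero digit. -/
def isQuasiGreedy (m : ℕ) (q : ℝ) (a : ℕ → ℕ) : Prop :=
  isExpansion m q 1 a ∧ ¬ hasLastNonzero a ∧
  ∀ b, isExpansion m q 1 b → ¬ hasLastNonzero b → lexLe b a

/-- `A'_q = {(c_i) ∈ U'_q : c_1 < α_1(q)}`. -/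
def Aq' (m : ℕ) (q : ℝ) : Set (ℕ → ℕ) :=
  {c | c ∈ Uq' m q ∧ ∀ a, isQuasiGreedy m q a → c 0 < a 0}

/-- `f_{c,d}(t) = (m+1)/t + Σ_{i≥1} (c_i + d_i) t^{-(i+1)} - m/(t-1)`. -/
noncomputable def fcd (m : ℕ) (c d : ℕ → ℕ) (t : ℝ) : ℝ :=
  ((m : ℝ) + 1) / t + (∑' i : ℕ, ((c i : ℝ) + (d i : ℝ)) / t ^ (i + 2)) - (m : ℝ) / (t - 1)

/-- `x = q_f(m)`: the largest real root of `q³-(k+2)q²+q-(k+1)=0` if `m = 2k+1`,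
and of `q²-(k+1)q-k=0` if `m = 2k`. -/
def isQf (m : ℕ) (x : ℝ) : Prop :=
  (∃ k : ℕ, m = 2 * k + 1 ∧
    x ^ 3 - ((k : ℝ) + 2) * x ^ 2 + x - ((k : ℝ) + 1) = 0 ∧
    ∀ y : ℝ, y ^ 3 - ((k : ℝ) + 2) * y ^ 2 + y - ((k : ℝ) + 1) = 0 → y ≤ x) ∨
  (∃ k : ℕ, m = 2 * k ∧
    x ^ 2 - ((k : ℝ) + 1) * x - (k : ℝ) = 0 ∧
    ∀ y : ℝ, y ^ 2 - ((k : ℝ) + 1) * y - (k : ℝ) = 0 → y ≤ x)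

/-- A doubly infinite sequence: neither it nor its reflection has a last nonzero digit. -/
def doublyInfinite (m : ℕ) (c : ℕ → ℕ) : Prop :=
  ¬ hasLastNonzero c ∧ ¬ hasLastNonzero (fun i => m - c i)

/-- `V_q`: points of `I_q` with at most one doubly infinite `q`-expansion. -/
def Vq (m : ℕ) (q : ℝ) : Set ℝ :=
  {x | x ∈ Set.Icc 0 ((m : ℝ) / (q - 1)) ∧
    ∀ a b : ℕ → ℕ, isExpansion m q x a → isExpansion m q x b →
      doublyInfinite m a → doublyInfinite m b → a = b}

/-- `U = {q ∈ (1, m+1] : 1 ∈ U_q}`. -/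
def Uset (m : ℕ) : Set ℝ := {q | q ∈ Set.Ioc 1 ((m : ℝ) + 1) ∧ (1 : ℝ) ∈ Uq m q}

/-- `V = {q ∈ (1, m+1] : 1 ∈ V_q}`. -/
def Vset (m : ℕ) : Set ℝ := {q | q ∈ Set.Ioc 1 ((m : ℝ) + 1) ∧ (1 : ℝ) ∈ Vq m q}

/-- The generalized golden ratio `G(m)`. -/
noncomputable def Gratio (m : ℕ) : ℝ :=
  if m % 2 = 0 then ((m / 2 : ℕ) : ℝ) + 1
  else (((m / 2 : ℕ) : ℝ) + 1 +
    Real.sqrt (((m / 2 : ℕ) : ℝ) ^ 2 + 6 * ((m / 2 : ℕ) : ℝ) + 5)) / 2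

/-- The set of accumulation points of a set of reals. -/
def accPts (S : Set ℝ) : Set ℝ := {x | AccPt x (Filter.principal S)}

/-- Iterated accumulation-point sets `B_2^{(i)}(m)`. -/
def B2iter (m : ℕ) : ℕ → Set ℝ
  | 0 => B2 m
  | n + 1 => accPts (B2iter m n)

/-- The value `∑ c_i q^{-i}` of a digit sequence. -/
noncomputable def digitVal (q : ℝ) (c : ℕ → ℕ) : ℝ := ∑' i : ℕ, (c i : ℝ) / q ^ (i + 1)

/-- Prepend a digit to a digit sequence. -/
def digitCons (a : ℕ) (c : ℕ → ℕ) : ℕ → ℕ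
  | 0 => a
  | n + 1 => c n

/-- Signed distance from the value of a digit sequence to the centre of `I_q`. -/
noncomputable def centreDev (m : ℕ) (q : ℝ) (c : ℕ → ℕ) : ℝ := m / (2 * (q - 1)) - digitVal q c

/-- Half the length of the interval `(m/(q-1) - 1, 1)`. -/
noncomputable def radius (m : ℕ) (q : ℝ) : ℝ := 1 - m / (2 * (q - 1))

/-- The lexicographic-type conditions that characterise unique expansions, stated through the
values of the tails. -/
def Admissible (m : ℕ) (q : ℝ) (c : ℕ → ℕ) : Prop :=
  ∀ n, c n ≤ m ∧ (0 < c n → centreDev m q (fun i => c (i + (n + 1))) < radius m q) ∧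
    (c n < m → -radius m q < centreDev m q (fun i => c (i + (n + 1))))

theorem hasSum_const_digit {q : ℝ} (hq : 1 < q) (m : ℝ) :
    HasSum (fun i : ℕ => m / q ^ (i + 1)) (m / (q - 1)) := by
  have h0 : 0 < q := by linarith
  have h := (hasSum_geometric_of_lt_one (inv_nonneg.2 h0.le) (inv_lt_one_of_one_lt₀ hq)).mul_left
    (m / q)
  have h1 : q - 1 ≠ 0 := by linarith
  have e1 : (fun i : ℕ => m / q ^ (i + 1)) = fun i => m / q * q⁻¹ ^ i := by
    ext i
    rw [inv_pow, pow_succ]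
    field_simp
  have e2 : m / (q - 1) = m / q * (1 - q⁻¹)⁻¹ := by
    have : 1 - q⁻¹ = (q - 1) / q := by field_simp
    rw [this]
    field_simp
  rwa [e1, e2]

theorem summable_digits {m : ℕ} {q : ℝ} (hq : 1 < q) {c : ℕ → ℕ} (hc : ∀ i, c i ≤ m) :
    Summable (fun i : ℕ => (c i : ℝ) / q ^ (i + 1)) := by
  have h0 : 0 < q := by linarith
  refine Summable.of_nonneg_of_le (fun i => by positivity) (fun i => ?_)
    (hasSum_const_digit hq m).summable
  have : (c i : ℝ) ≤ m := by exact_mod_cast hc i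
  gcongr

theorem digitVal_nonneg {q : ℝ} (hq : 1 < q) (c : ℕ → ℕ) : 0 ≤ digitVal q c := by
  have h0 : 0 < q := by linarith
  exact tsum_nonneg fun i => by positivity

theorem digitVal_le {m : ℕ} {q : ℝ} (hq : 1 < q) {c : ℕ → ℕ} (hc : ∀ i, c i ≤ m) :
    digitVal q c ≤ m / (q - 1) := by
  have h0 : 0 < q := by linarith
  rw [← (hasSum_const_digit hq m).tsum_eq]
  refine (summable_digits hq hc).tsum_le_tsum (fun i => ?_) (hasSum_const_digit hq m).summable
  have : (c i : ℝ) ≤ m := by exact_mod_cast hc i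
  gcongr

theorem digitVal_eq_sum_add {m : ℕ} {q : ℝ} (hq : 1 < q) {c : ℕ → ℕ} (hc : ∀ i, c i ≤ m) (n : ℕ) :
    digitVal q c = ∑ i ∈ Finset.range n, (c i : ℝ) / q ^ (i + 1) +
      digitVal q (fun i => c (i + n)) / q ^ n := by
  have h0 : 0 < q := by linarith
  rw [digitVal, ← (summable_digits hq hc).sum_add_tsum_nat_add n, digitVal, ← tsum_div_const]
  congr 1
  refine tsum_congr fun i => ?_
  rw [div_div, ← pow_add]
  congr 2
  ring

theorem mul_digitVal {m : ℕ} {q : ℝ} (hq : 1 < q) {c : ℕ → ℕ} (hc : ∀ i, c i ≤ m) :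
    q * digitVal q c = c 0 + digitVal q (fun i => c (i + 1)) := by
  have h0 : 0 < q := by linarith
  rw [digitVal_eq_sum_add hq hc 1]
  simp
  field_simp

theorem mul_digitVal_cons {m : ℕ} {q : ℝ} (hq : 1 < q) {a : ℕ} (ha : a ≤ m) {c : ℕ → ℕ}
    (hc : ∀ i, c i ≤ m) : q * digitVal q (digitCons a c) = a + digitVal q c := by
  rw [mul_digitVal (m := m) hq]
  · rfl
  · rintro (_ | i)
    exacts [ha, hc i]

theorem digitVal_tail_eq {m : ℕ} {q : ℝ} (hq : 1 < q) {a b : ℕ → ℕ} (ha : ∀ i, a i ≤ m)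
    (hb : ∀ i, b i ≤ m) {n : ℕ} (hab : ∀ i < n, a i = b i) (h : digitVal q a = digitVal q b) :
    digitVal q (fun i => a (i + n)) = digitVal q (fun i => b (i + n)) := by
  have h0 : 0 < q := by linarith
  rw [digitVal_eq_sum_add hq ha n, digitVal_eq_sum_add hq hb n,
    Finset.sum_congr rfl fun i hi => by rw [hab i (Finset.mem_range.1 hi)]] at h
  have := add_left_cancel h
  field_simp at this
  exact this

/-- Every point of `I_q` has a `q`-expansion. -/
theorem exists_isExpansion {m : ℕ} {q : ℝ} (hq : 1 < q) (hqm : q ≤ m + 1) {x : ℝ} (hx : 0 ≤ x)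
    (hx' : x ≤ m / (q - 1)) : ∃ c, isExpansion m q x c := by
  have h0 : 0 < q := by linarith
  have h1 : 0 < q - 1 := by linarith
  have hS : 1 ≤ m / (q - 1) := by rw [le_div_iff₀ h1]; linarith
  let d : ℝ → ℕ := fun y => min m ⌊q * y⌋₊
  let y : ℕ → ℝ := fun n => Nat.rec x (fun _ z => q * z - d z) n
  have hy0 : y 0 = x := rfl
  have hys : ∀ n, y (n + 1) = q * y n - d (y n) := fun n => rfl
  have hy : ∀ n, 0 ≤ y n ∧ y n ≤ m / (q - 1) := by
    intro n
    induction n with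
    | zero => exact ⟨hx, hx'⟩
    | succ n ih =>
      rw [hys]
      have hqy : 0 ≤ q * y n := mul_nonneg h0.le ih.1
      have hfl := Nat.floor_le hqy
      have hfl' := Nat.lt_floor_add_one (q * y n)
      rcases le_total m ⌊q * y n⌋₊ with h | h
      · have e : d (y n) = m := min_eq_left h
        have h' : (m : ℝ) ≤ ⌊q * y n⌋₊ := by exact_mod_cast h
        rw [e]
        refine ⟨by linarith, ?_⟩
        have : q * y n ≤ q * (m / (q - 1)) := by gcongr; exact ih.2
        have e2 : q * ((m : ℝ) / (q - 1)) - m = m / (q - 1) := by field_simp; ring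
        linarith
      · have e : d (y n) = ⌊q * y n⌋₊ := min_eq_right h
        rw [e]
        exact ⟨by linarith, by linarith⟩
  have hc : ∀ i, d (y i) ≤ m := fun i => min_le_left _ _
  refine ⟨fun i => d (y i), hc, ?_⟩
  have hpart : ∀ n, ∑ i ∈ Finset.range n, (d (y i) : ℝ) / q ^ (i + 1) = x - y n / q ^ n := by
    intro n
    induction n with
    | zero => simp [hy0]
    | succ n ih =>
      rw [Finset.sum_range_succ, ih, hys]
      field_simp
      ring
  have hlim : Filter.Tendsto (fun n => x - y n / q ^ n) Filter.atTop (nhds (x - 0)) := by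
    refine Filter.Tendsto.sub tendsto_const_nhds ?_
    refine squeeze_zero (fun n => div_nonneg (hy n).1 (by positivity))
      (fun n => div_le_div_of_nonneg_right (hy n).2 (by positivity)) ?_
    exact Filter.Tendsto.div_atTop tendsto_const_nhds (tendsto_pow_atTop_atTop_of_one_lt hq)
  have h2 := (summable_digits hq hc).hasSum.tendsto_sum_nat
  simp only [hpart] at h2
  simpa using tendsto_nhds_unique hlim h2

theorem mul_centreDev {m : ℕ} {q : ℝ} (hq : 1 < q) {c : ℕ → ℕ} (hc : ∀ i, c i ≤ m) :
    q * centreDev m q c = m / 2 - c 0 + centreDev m q (fun i => c (i + 1)) := by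
  have h1 : q - 1 ≠ 0 := by linarith
  have := mul_digitVal hq hc
  have e : q * ((m : ℝ) / (2 * (q - 1))) = m / 2 + m / (2 * (q - 1)) := by field_simp; ring
  rw [centreDev, centreDev, mul_sub, this, e]
  ring

theorem half_add_half (m : ℕ) (q : ℝ) :
    (m : ℝ) / (q - 1) = m / (2 * (q - 1)) + m / (2 * (q - 1)) := by
  rw [mul_comm, ← div_div]
  ring

theorem abs_centreDev_le {m : ℕ} {q : ℝ} (hq : 1 < q) {c : ℕ → ℕ} (hc : ∀ i, c i ≤ m) :
    |centreDev m q c| ≤ m / (2 * (q - 1)) := by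
  have h1 := digitVal_nonneg hq c
  have h2 := digitVal_le hq hc
  rw [half_add_half] at h2
  rw [centreDev, abs_le]
  constructor <;> linarith

theorem digit_le_of_mem_Uq' {m : ℕ} {q : ℝ} {c : ℕ → ℕ} (hc : c ∈ Uq' m q) : ∀ i, c i ≤ m := hc.1.1

theorem eq_of_mem_Uq' {m : ℕ} {q : ℝ} {c d : ℕ → ℕ} (hc : c ∈ Uq' m q) (hd : ∀ i, d i ≤ m)
    (h : digitVal q c = digitVal q d) : d = c := hc.2 d ⟨hd, h⟩

theorem shift_mem_Uq' {m : ℕ} {q : ℝ} (hq : 1 < q) {c : ℕ → ℕ} (hc : c ∈ Uq' m q) :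
    (fun i => c (i + 1)) ∈ Uq' m q := by
  have hm := digit_le_of_mem_Uq' hc
  refine ⟨⟨fun i => hm _, rfl⟩, fun d hd => ?_⟩
  have h : digitCons (c 0) d = c := by
    refine eq_of_mem_Uq' hc ?_ ?_
    · rintro (_ | i)
      exacts [hm 0, hd.1 i]
    · have h1 := mul_digitVal hq hm
      have h2 := mul_digitVal_cons hq (hm 0) hd.1
      have h3 : digitVal q (fun i => c (i + 1)) = digitVal q d := hd.2
      have h0 : q ≠ 0 := by linarith
      exact mul_left_cancel₀ h0 (by rw [h1, h2, h3])
  rw [← h]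
  rfl

theorem centreDev_shift_of_mem_Uq' {m : ℕ} {q : ℝ} (hq : 1 < q) (hqm : q ≤ m + 1) {c : ℕ → ℕ}
    (hc : c ∈ Uq' m q) :
    (0 < c 0 → centreDev m q (fun i => c (i + 1)) < radius m q) ∧
    (c 0 < m → -radius m q < centreDev m q (fun i => c (i + 1))) := by
  have h0 : q ≠ 0 := by linarith
  have hm := digit_le_of_mem_Uq' hc
  have key : ∀ (a : ℕ) (e : ℕ → ℕ), a ≤ m → (∀ i, e i ≤ m) →
      (a : ℝ) + digitVal q e = c 0 + digitVal q (fun i => c (i + 1)) → a = c 0 := by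
    intro a e ha he h
    have h1 := mul_digitVal hq hm
    have h2 := mul_digitVal_cons hq ha he
    have : digitCons a e = c := by
      refine eq_of_mem_Uq' hc ?_ (mul_left_cancel₀ h0 (by rw [h1, h2, h]))
      rintro (_ | i)
      exacts [ha, he i]
    rw [← this]
    rfl
  have hs := fun i => hm (i + 1)
  have hv0 := digitVal_nonneg hq (fun i => c (i + 1))
  have hv1 := digitVal_le hq hs
  have hS := half_add_half m q
  constructor
  · intro hpos
    by_contra! hcon
    rw [centreDev, radius] at hcon
    obtain ⟨e, he⟩ := exists_isExpansion hq hqm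
      (x := digitVal q (fun i => c (i + 1)) + 1) (by linarith) (by linarith)
    have h2 : digitVal q (fun i => c (i + 1)) + 1 = digitVal q e := he.2
    have := key (c 0 - 1) e ((Nat.sub_le _ _).trans (hm 0)) he.1
      (by rw [← h2, Nat.cast_sub hpos]; push_cast; ring)
    omega
  · intro hlt
    by_contra! hcon
    rw [centreDev, radius] at hcon
    obtain ⟨e, he⟩ := exists_isExpansion hq hqm
      (x := digitVal q (fun i => c (i + 1)) - 1) (by linarith) (by linarith)
    have h2 : digitVal q (fun i => c (i + 1)) - 1 = digitVal q e := he.2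
    have := key (c 0 + 1) e hlt he.1 (by rw [← h2]; push_cast; ring)
    omega

theorem Admissible.mem_Uq' {m : ℕ} {q : ℝ} (hq : 1 < q) {c : ℕ → ℕ} (hc : Admissible m q c) :
    c ∈ Uq' m q := by
  have hm : ∀ i, c i ≤ m := fun i => (hc i).1
  refine ⟨⟨hm, rfl⟩, fun d hd => ?_⟩
  by_contra hne
  have hex : ∃ n, d n ≠ c n := by
    by_contra! h
    exact hne (funext h)
  classical
  have hn := Nat.find_spec hex
  have hlt : ∀ i < Nat.find hex, c i = d i := fun i hi => by
    have := Nat.find_min hex hi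
    push Not at this
    exact this.symm
  set n := Nat.find hex
  have ht := digitVal_tail_eq hq hm hd.1 hlt hd.2
  have h1 := mul_digitVal hq (fun i => hm (i + n))
  have h2 := mul_digitVal hq (fun i => hd.1 (i + n))
  simp only [zero_add] at h1 h2
  have e : ∀ f : ℕ → ℕ, (fun i => f (i + 1 + n)) = fun i => f (i + (n + 1)) := fun f => by
    ext i
    congr 1
    ring
  rw [e] at h1 h2
  rw [ht, h2] at h1
  obtain ⟨-, hp, hl⟩ := hc n
  have hS := half_add_half m q
  have hd0 := digitVal_nonneg hq (fun i => d (i + (n + 1)))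
  have hd1 := digitVal_le hq (fun i => hd.1 (i + (n + 1)))
  rcases lt_or_gt_of_ne hn with h | h
  · have := hp (by omega)
    rw [centreDev, radius] at this
    have h' : (d n : ℝ) + 1 ≤ c n := by exact_mod_cast h
    linarith
  · have := hl (h.trans_le (hd.1 n))
    rw [centreDev, radius] at this
    have h' : (c n : ℝ) + 1 ≤ d n := by exact_mod_cast h
    linarith

theorem Admissible.cons {m : ℕ} {q : ℝ} {c : ℕ → ℕ} (hc : Admissible m q c) {a : ℕ} (ha : a ≤ m)
    (h1 : 0 < a → centreDev m q c < radius m q) (h2 : a < m → -radius m q < centreDev m q c) :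
    Admissible m q (digitCons a c) := by
  rintro (_ | n)
  · exact ⟨ha, h1, h2⟩
  · exact hc n

/-- Two unique expansions whose values differ by `1` produce a point with two expansions. -/
theorem mem_B2_of_admissible {m : ℕ} (hm : 0 < m) {q : ℝ} (hq : 1 < q) (hqm : q ≤ m + 1)
    (hr : 0 < radius m q) {c d : ℕ → ℕ} (hc : Admissible m q c) (hd : Admissible m q d)
    (h : centreDev m q c - centreDev m q d = 1) : q ∈ B2 m := by
  have h0 : q ≠ 0 := by linarith
  have hcm : ∀ i, c i ≤ m := fun i => (hc i).1
  have hdm : ∀ i, d i ≤ m := fun i => (hd i).1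
  have hcu := hc.mem_Uq' hq
  have hdu := hd.mem_Uq' hq
  have hv : digitVal q d = 1 + digitVal q c := by
    rw [centreDev, centreDev] at h
    linarith
  have e0 := mul_digitVal_cons hq (Nat.zero_le m) hdm
  have e1 := mul_digitVal_cons hq (show 1 ≤ m from hm) hcm
  push_cast at e0 e1
  have hxm : ∀ i, digitCons 0 d i ≤ m := by
    rintro (_ | i)
    exacts [Nat.zero_le _, hdm i]
  have hym : ∀ i, digitCons 1 c i ≤ m := by
    rintro (_ | i)
    exacts [hm, hcm i]
  refine ⟨⟨hq, hqm⟩, digitVal q (digitCons 0 d), ⟨digitVal_nonneg hq _, digitVal_le hq hxm⟩,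
    digitCons 0 d, digitCons 1 c, ?_, ⟨hxm, rfl⟩, ⟨hym, ?_⟩, ?_⟩
  · intro h
    have := congrFun h 0
    simp [digitCons] at this
  · change _ = digitVal q (digitCons 1 c)
    exact mul_left_cancel₀ h0 (by rw [e0, hv, e1]; ring)
  · intro e he
    have hev : digitVal q (digitCons 0 d) = digitVal q e := he.2
    have e2 := mul_digitVal hq he.1
    rw [← hev, e0] at e2
    have hcons : e = digitCons (e 0) (fun i => e (i + 1)) := by
      ext (_ | i) <;> rfl
    have hsm := fun i => he.1 (i + 1)
    have hs0 := digitVal_nonneg hq (fun i => e (i + 1))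
    rcases Nat.lt_trichotomy (e 0) 1 with h1 | h1 | h1
    · left
      have h1 : e 0 = 0 := by omega
      rw [hcons, h1, eq_of_mem_Uq' hdu hsm (by rw [h1] at e2; push_cast at e2; linarith)]
    · right
      rw [hcons, h1, eq_of_mem_Uq' hcu hsm (by rw [h1] at e2; push_cast at e2; linarith)]
    · exfalso
      have h2 : (2 : ℝ) ≤ e 0 := by exact_mod_cast h1
      have h3 := digitVal_le hq hdm
      rw [half_add_half] at h3
      rw [radius] at hr
      linarith

/-- The tails of the two expansions of a point with exactly two expansions. -/
theorem exists_of_mem_B2 {m : ℕ} {q : ℝ} (h : q ∈ B2 m) :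
    ∃ c ∈ Uq' m q, ∃ d ∈ Uq' m q, ∃ g : ℕ, 1 ≤ g ∧ g ≤ m ∧
      centreDev m q c - centreDev m q d = g := by
  obtain ⟨⟨hq, hqm⟩, x, -, a, b, hab, ha, hb, hall⟩ := h
  have h0 : q ≠ 0 := by linarith
  have hex : ∃ n, a n ≠ b n := by
    by_contra! h
    exact hab (funext h)
  classical
  have hn := Nat.find_spec hex
  have hlt : ∀ i < Nat.find hex, a i = b i := fun i hi => by
    have := Nat.find_min hex hi
    push Not at this
    exact this
  generalize Nat.find hex = n at hn hlt
  have main : ∀ a b : ℕ → ℕ, isExpansion m q x a → isExpansion m q x b →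
      (∀ c, isExpansion m q x c → c = a ∨ c = b) → (∀ i < n, a i = b i) → a n ≠ b n →
      (fun i => a (i + (n + 1))) ∈ Uq' m q := by
    intro a b ha hb hall hlt hn
    refine ⟨⟨fun i => ha.1 _, rfl⟩, fun d hd => ?_⟩
    set e : ℕ → ℕ := fun i => if i < n + 1 then a i else d (i - (n + 1)) with he
    have het : (fun i => e (i + (n + 1))) = d := by
      ext i
      simp only [he]
      rw [if_neg (by omega), Nat.add_sub_cancel]
    have hem : ∀ i, e i ≤ m := by
      intro i
      simp only [he]
      split_ifs
      exacts [ha.1 i, hd.1 _]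
    have hev : isExpansion m q x e := by
      refine ⟨hem, ?_⟩
      rw [ha.2]
      change digitVal q a = digitVal q e
      rw [digitVal_eq_sum_add hq ha.1 (n + 1), digitVal_eq_sum_add hq hem (n + 1), het]
      congr 1
      · refine Finset.sum_congr rfl fun i hi => ?_
        simp only [he, if_pos (Finset.mem_range.1 hi)]
      · congr 1
        exact hd.2
    rcases hall e hev with h | h
    · rw [← het, h]
    · exfalso
      apply hn
      rw [← h]
      simp [he]
  have hau := main a b ha hb hall hlt hn
  have hbu := main b a hb ha (fun c hc => (hall c hc).symm) (fun i hi => (hlt i hi).symm) hn.symm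
  have ht := digitVal_tail_eq hq ha.1 hb.1 hlt (ha.2.symm.trans hb.2)
  have h1 := mul_digitVal hq (fun i => ha.1 (i + n))
  have h2 := mul_digitVal hq (fun i => hb.1 (i + n))
  simp only [zero_add] at h1 h2
  have e : ∀ f : ℕ → ℕ, (fun i => f (i + 1 + n)) = fun i => f (i + (n + 1)) := fun f => by
    ext i
    congr 1
    ring
  rw [e] at h1 h2
  rw [ht, h2] at h1
  have ham := ha.1 n
  have hbm := hb.1 n
  rcases lt_or_gt_of_ne hn with h | h
  · refine ⟨_, hbu, _, hau, b n - a n, by omega, by omega, ?_⟩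
    rw [Nat.cast_sub h.le, centreDev, centreDev]
    linarith
  · refine ⟨_, hau, _, hbu, a n - b n, by omega, by omega, ?_⟩
    rw [Nat.cast_sub h.le, centreDev, centreDev]
    linarith

/-- A symmetric bounded set of reals in which every element has a digit leading to another element,
subject to the conditions satisfied by the tails of unique expansions. -/
structure IsOrbitSet (m : ℕ) (q : ℝ) (D : Set ℝ) : Prop where
  neg_mem : ∀ w ∈ D, -w ∈ D
  abs_mem_le : ∀ w ∈ D, |w| ≤ m / (2 * (q - 1))
  step : ∀ w ∈ D, ∃ a ≤ m, ∃ w' ∈ D, q * w = m / 2 - a + w' ∧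
    (0 < a → w' < radius m q) ∧ (a < m → -radius m q < w')

theorem isOrbitSet_centreDev {m : ℕ} {q : ℝ} (hq : 1 < q) (hqm : q ≤ m + 1) :
    IsOrbitSet m q {w | ∃ c ∈ Uq' m q, w = centreDev m q c ∨ w = -centreDev m q c} where
  neg_mem := by
    rintro w ⟨c, hc, h | h⟩
    · exact ⟨c, hc, Or.inr (by rw [h])⟩
    · exact ⟨c, hc, Or.inl (by rw [h, neg_neg])⟩
  abs_mem_le := by
    rintro w ⟨c, hc, h | h⟩ <;> rw [h]
    · exact abs_centreDev_le hq (digit_le_of_mem_Uq' hc)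
    · rw [abs_neg]
      exact abs_centreDev_le hq (digit_le_of_mem_Uq' hc)
  step := by
    rintro w ⟨c, hc, h⟩
    have hm := digit_le_of_mem_Uq' hc
    have hs := shift_mem_Uq' hq hc
    have e := mul_centreDev hq hm
    obtain ⟨h1, h2⟩ := centreDev_shift_of_mem_Uq' hq hqm hc
    rcases h with h | h
    · exact ⟨c 0, hm 0, _, ⟨_, hs, Or.inl rfl⟩, by rw [h, e], h1, h2⟩
    · refine ⟨m - c 0, Nat.sub_le _ _, _, ⟨_, hs, Or.inr rfl⟩, ?_, fun h => ?_, fun h => ?_⟩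
      · rw [h, mul_neg, e, Nat.cast_sub (hm 0)]
        ring
      · have := h2 (by omega)
        linarith
      · have := h1 (by omega)
        linarith

theorem eq_zero_of_pow_mul_abs_le {q x B : ℝ} (hq : 1 < q) (h : ∀ n : ℕ, q ^ n * |x| ≤ B) :
    x = 0 := by
  by_contra hx
  have hx' : 0 < |x| := abs_pos.2 hx
  obtain ⟨n, hn⟩ := pow_unbounded_of_one_lt (B / |x|) hq
  rw [div_lt_iff₀ hx'] at hn
  exact absurd (h n) (not_le.2 hn)

/-- Without survivors in `(-r, r)`, an orbit set contains at most the two trivial points. -/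
theorem IsOrbitSet.eq_of_forall_not {m : ℕ} (hm : 0 < m) {q : ℝ} (hq : 1 < q) {D : Set ℝ}
    (hD : IsOrbitSet m q D) (hno : ∀ w ∈ D, ¬ |w| < radius m q) {w : ℝ} (hw : w ∈ D)
    (hw0 : 0 ≤ w) : w = m / (2 * (q - 1)) := by
  have hm' : (1 : ℝ) ≤ m := by exact_mod_cast hm
  have hno' : ∀ w ∈ D, w < radius m q → w ≤ -radius m q := by
    intro w hw h
    by_contra! hc
    exact hno w hw (abs_lt.2 ⟨hc, h⟩)
  have hstep : ∀ w ∈ D, 0 ≤ w → ∃ w' ∈ D, 0 ≤ w' ∧ q * w = m / 2 + w' := by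
    intro w hw h0
    obtain ⟨a, ha, w', hw', e, h1, h2⟩ := hD.step w hw
    have hqw : 0 ≤ q * w := by positivity
    rcases Nat.eq_zero_or_pos a with rfl | ha0
    · refine ⟨w', hw', ?_, by simpa using e⟩
      have h3 := h2 hm
      by_contra! hc
      exact hno w' hw' (abs_lt.2 ⟨h3, by linarith⟩)
    · exfalso
      have h3 := h1 ha0
      have h4 := hno' w' hw' h3
      rcases ha.lt_or_eq with h | rfl
      · linarith [h2 h]
      · linarith
  have hq1 : q - 1 ≠ 0 := by linarith
  have hfix : q * ((m : ℝ) / (2 * (q - 1))) = m / 2 + m / (2 * (q - 1)) := by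
    field_simp
    ring
  have hiter : ∀ n : ℕ, ∃ w' ∈ D, 0 ≤ w' ∧
      q ^ n * (m / (2 * (q - 1)) - w) = m / (2 * (q - 1)) - w' := by
    intro n
    induction n with
    | zero => exact ⟨w, hw, hw0, by ring⟩
    | succ n ih =>
      obtain ⟨w', hw', h0, e⟩ := ih
      obtain ⟨w'', hw'', h0', e'⟩ := hstep w' hw' h0
      exact ⟨w'', hw'', h0', by rw [pow_succ', mul_assoc, e, mul_sub, hfix, e']; ring⟩
  have hle := (le_abs_self w).trans (hD.abs_mem_le w hw)
  have : m / (2 * (q - 1)) - w = 0 := by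
    refine eq_zero_of_pow_mul_abs_le hq (B := m / (2 * (q - 1))) fun n => ?_
    obtain ⟨w', hw', h0, e⟩ := hiter n
    rw [abs_of_nonneg (by linarith), e]
    linarith
  linarith

theorem IsOrbitSet.eq_or_exists_survivor {m : ℕ} (hm : 0 < m) {q : ℝ} (hq : 1 < q) {D : Set ℝ}
    (hD : IsOrbitSet m q D) {w₁ w₂ : ℝ} (h₁ : w₁ ∈ D) (h₂ : w₂ ∈ D) {g : ℕ} (hg : 1 ≤ g)
    (h : w₁ + w₂ = g) :
    q = m / g + 1 ∨ (g = 1 ∧ 0 < radius m q ∧ ∃ w ∈ D, |w| < radius m q) := by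
  have hg' : (1 : ℝ) ≤ g := by exact_mod_cast hg
  have b₁ := abs_le.1 (hD.abs_mem_le w₁ h₁)
  have b₂ := abs_le.1 (hD.abs_mem_le w₂ h₂)
  by_cases hex : ∃ w ∈ D, |w| < radius m q
  · right
    obtain ⟨w, hw, hwr⟩ := hex
    have hr := (abs_nonneg w).trans_lt hwr
    refine ⟨?_, hr, w, hw, hwr⟩
    rw [radius] at hr
    have : (g : ℝ) < 2 := by linarith [b₁.2, b₂.2]
    have : g < 2 := by exact_mod_cast this
    omega
  · left
    push Not at hex
    have hno : ∀ w ∈ D, ¬ |w| < radius m q := fun w hw => not_lt.2 (hex w hw)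
    have hq1 : q - 1 ≠ 0 := by linarith
    have hpos : ∀ w ∈ D, w < 0 → w = -(m / (2 * (q - 1))) := fun w hw h0 => by
      rw [← hD.eq_of_forall_not hm hq hno (hD.neg_mem w hw) (by linarith), neg_neg]
    have e : (g : ℝ) = m / (q - 1) := by
      rw [half_add_half]
      rcases le_or_gt 0 w₁ with c₁ | c₁ <;> rcases le_or_gt 0 w₂ with c₂ | c₂
      · rw [← h, hD.eq_of_forall_not hm hq hno h₁ c₁, hD.eq_of_forall_not hm hq hno h₂ c₂]
      · linarith [hD.eq_of_forall_not hm hq hno h₁ c₁, hpos _ h₂ c₂]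
      · linarith [hD.eq_of_forall_not hm hq hno h₂ c₂, hpos _ h₁ c₁]
      · linarith
    have : (g : ℝ) ≠ 0 := by linarith
    field_simp at e ⊢
    linarith

theorem even_trichotomy {k : ℕ} (hk : 0 < k) {q : ℝ} (hq : 1 < q)
    (hlt : q ^ 2 - (k + 1) * q - k < 0) {D : Set ℝ} (hD : IsOrbitSet (2 * k) q D) {w₁ w₂ : ℝ}
    (h₁ : w₁ ∈ D) (h₂ : w₂ ∈ D) {g : ℕ} (hg : 1 ≤ g) (h : w₁ + w₂ = g) :
    q = (2 * k : ℕ) / g + 1 ∨ (∃ n ≤ 2 * k, q = n) ∨ ∃ j ≤ k, q ^ 2 - (k + 1) * q = j := by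
  rcases hD.eq_or_exists_survivor (by omega) hq h₁ h₂ hg h with e | ⟨rfl, hr, -⟩
  · exact Or.inl e
  right
  have hk' : (1 : ℝ) ≤ k := by exact_mod_cast hk
  have hq1 : 0 < q - 1 := by linarith
  set r := radius (2 * k) q with hrdef
  have hS : ((2 * k : ℕ) : ℝ) / (2 * (q - 1)) = 1 - r := by rw [hrdef, radius]; ring
  have hrq : r * (q - 1) = q - 1 - k := by
    rw [hrdef, radius]
    push_cast
    field_simp
  have hr1 : r * (q + 1) < 1 := by
    by_contra! hc
    nlinarith
  have hb : ∀ w ∈ D, |w| ≤ 1 - r := fun w hw => hS ▸ hD.abs_mem_le w hw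
  have hqk : (k : ℝ) + 1 < q := by nlinarith
  have hqk2 : q < k + 2 := by nlinarith
  have hstep : ∀ w ∈ D, ∃ a ≤ 2 * k, ∃ w' ∈ D, q * w = k - a + w' ∧
      (0 < a → w' < r) ∧ (a < 2 * k → -r < w') := by
    intro w hw
    obtain ⟨a, ha, w', hw', e, h⟩ := hD.step w hw
    exact ⟨a, ha, w', hw', by rw [e]; push_cast; ring, h⟩
  have hsurv1 : ∀ w ∈ D, |w| < r → q * w ∈ D ∧ |q * w| < r := by
    intro w hw hwr
    rw [abs_lt] at hwr
    obtain ⟨a, ha, w', hw', e, h1, h2⟩ := hstep w hw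
    have hu : q * w < q * r := by nlinarith
    have hl : -(q * r) < q * w := by nlinarith
    rcases lt_trichotomy a k with c | c | c
    · have c' : (a : ℝ) + 1 ≤ k := by exact_mod_cast c
      linarith [h2 (by omega)]
    · have e' : q * w = w' := by rw [e, c]; ring
      rw [e']
      exact ⟨hw', abs_lt.2 ⟨h2 (by omega), h1 (by omega)⟩⟩
    · have c' : (k : ℝ) + 1 ≤ a := by exact_mod_cast c
      linarith [h1 (by omega)]
  have hsurv : ∀ w ∈ D, |w| < r → w = 0 := by
    intro w hw hwr
    have hi : ∀ n : ℕ, q ^ n * w ∈ D ∧ |q ^ n * w| < r := by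
      intro n
      induction n with
      | zero => simpa using ⟨hw, hwr⟩
      | succ n ih =>
        rw [pow_succ', mul_assoc]
        exact hsurv1 _ ih.1 ih.2
    refine eq_zero_of_pow_mul_abs_le hq (B := r) fun n => ?_
    have := (hi n).2.le
    rwa [abs_mul, abs_of_pos (by positivity)] at this
  have hcases : ∀ w ∈ D, r ≤ w → (∃ j, 1 ≤ j ∧ j ≤ k ∧ q * w = (j : ℕ)) ∨
      ∃ w' ∈ D, r ≤ w' ∧ q * w = k + w' := by
    intro w hw hwr
    obtain ⟨a, ha, w', hw', e, h1, h2⟩ := hstep w hw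
    have hw0 : 0 < w := by linarith
    have hqw : 0 < q * w := by positivity
    have fin : |w'| < r → a ≤ k → ∃ j, 1 ≤ j ∧ j ≤ k ∧ q * w = (j : ℕ) := by
      intro hr' hak
      rw [hsurv w' hw' hr', add_zero] at e
      have : (a : ℝ) < k := by linarith
      have : a < k := by exact_mod_cast this
      exact ⟨k - a, by omega, by omega, by rw [Nat.cast_sub hak, e]⟩
    rcases Nat.eq_zero_or_pos a with rfl | ha0
    · have h3 := h2 (by omega)
      rcases lt_or_ge w' r with h4 | h4
      · exact Or.inl (fin (abs_lt.2 ⟨h3, h4⟩) (by omega))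
      · exact Or.inr ⟨w', hw', h4, by simpa using e⟩
    · left
      have h3 := h1 ha0
      by_cases hak : a ≤ k
      · exact fin (abs_lt.2 ⟨h2 (by omega), h3⟩) hak
      · exfalso
        have c' : (k : ℝ) + 1 ≤ a := by exact_mod_cast (not_le.1 hak)
        nlinarith
  have hmix : ∀ w₁ ∈ D, ∀ w₂ ∈ D, r ≤ w₁ → ∀ j : ℕ, 1 ≤ j → q * w₂ = j →
      ∀ w' ∈ D, r ≤ w' → q * w₁ = k + w' → w₁ + w₂ = 1 → ∃ j ≤ k, q ^ 2 - (k + 1) * q = (j : ℕ) := by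
    intro w₁ _ w₂ _ _ j hj e₂ w' hw' hr' e₁ h
    have e : q = k + w' + j := by rw [← e₁, ← e₂, ← mul_add, h, mul_one]
    have hj1 : j = 1 := by
      by_contra hne
      have : (2 : ℝ) ≤ j := by exact_mod_cast (show 2 ≤ j by omega)
      linarith
    rw [hj1, Nat.cast_one] at e
    have ew : w' = q - (k + 1) := by linarith
    rcases hcases w' hw' hr' with ⟨i, -, hi, ei⟩ | ⟨w'', -, hr'', ei⟩
    · exact ⟨i, hi, by rw [← ei, ew]; ring⟩
    · rw [ew] at ei
      nlinarith
  rw [Nat.cast_one] at h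
  have hr₁ : r ≤ w₁ := by linarith [(abs_le.1 (hb w₂ h₂)).2]
  have hr₂ : r ≤ w₂ := by linarith [(abs_le.1 (hb w₁ h₁)).2]
  rcases hcases w₁ h₁ hr₁ with ⟨j₁, hj₁, hj₁', e₁⟩ | ⟨w₁', h₁', hr₁', e₁⟩ <;>
    rcases hcases w₂ h₂ hr₂ with ⟨j₂, hj₂, hj₂', e₂⟩ | ⟨w₂', h₂', hr₂', e₂⟩
  · left
    refine ⟨j₁ + j₂, by omega, ?_⟩
    rw [Nat.cast_add, ← e₁, ← e₂, ← mul_add, h, mul_one]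
  · exact Or.inr (hmix w₂ h₂ w₁ h₁ hr₂ j₁ hj₁ e₁ w₂' h₂' hr₂' e₂ (by linarith))
  · exact Or.inr (hmix w₁ h₁ w₂ h₂ hr₁ j₂ hj₂ e₂ w₁' h₁' hr₁' e₁ h)
  · exfalso
    have hge : ∀ w ∈ D, r ≤ w → 1 ≤ q * w := by
      intro w hw hwr
      rcases hcases w hw hwr with ⟨j, hj, -, e⟩ | ⟨w', -, hr', e⟩
      · rw [e]
        exact_mod_cast hj
      · linarith
    have g₁ := hge w₁' h₁' hr₁'
    have g₂ := hge w₂' h₂' hr₂'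
    have e : q = 2 * k + w₁' + w₂' := by linear_combination e₁ + e₂ - q * h
    have e2 : q * q = 2 * k * q + q * w₁' + q * w₂' := by linear_combination q * e
    nlinarith

/-- The set of `w` for which `q * w` is one of `1/2, 3/2, …, (2 * k + 1)/2` up to the
perturbation `± 1 / (2 * (q + 1))`. -/
def terminalSet (k : ℕ) (q : ℝ) : Set ℝ :=
  {w | ∃ H ≤ k, ∃ s ∈ ({1, -1} : Finset ℝ), q * w = (H : ℕ) + 1 / 2 + s / (2 * (q + 1))}

theorem odd_survivor {k : ℕ} {q : ℝ} (hq : 1 < q) (hr : 0 < radius (2 * k + 1) q)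
    (hqk2 : q < k + 2) (hlt : q ^ 3 - (k + 2) * q ^ 2 + q - (k + 1) < 0) {D : Set ℝ}
    (hD : IsOrbitSet (2 * k + 1) q D) {w : ℝ} (hw : w ∈ D) (hwr : |w| < radius (2 * k + 1) q) :
    ∃ s ∈ ({1, -1} : Finset ℝ), w = s / (2 * (q + 1)) := by
  have hq1 : 0 < q - 1 := by linarith
  set r := radius (2 * k + 1) q with hrdef
  have hrq : r * (q - 1) = q - 1 - (k + 1 / 2) := by
    rw [hrdef, radius]
    push_cast
    field_simp
  have hk' : (0 : ℝ) ≤ k := by positivity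
  have hr2 : r < 1 / 2 := by nlinarith
  have hr3 : r * (q + 1) < 3 / 2 := by nlinarith
  have hr4 : r * (q ^ 2 + 1) < (q + 1) / 2 := by
    by_contra! hc
    nlinarith
  have hstep : ∀ w ∈ D, |w| < r → ∃ w' ∈ D, |w'| < r ∧ (q * w = 1 / 2 + w' ∨ q * w = -1 / 2 + w') := by
    intro w hw hwr
    rw [abs_lt] at hwr
    obtain ⟨a, ha, w', hw', e, h1, h2⟩ := hD.step w hw
    push_cast at e
    have hu : q * w < q * r := by nlinarith
    have hl : -(q * r) < q * w := by nlinarith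
    rcases le_or_gt a k with c | c
    · have h3 := h2 (by omega)
      have hak : a = k := by
        by_contra hne
        have : (a : ℝ) + 1 ≤ k := by exact_mod_cast (show a + 1 ≤ k by omega)
        linarith
      rw [hak] at e
      exact ⟨w', hw', abs_lt.2 ⟨h3, by linarith⟩, Or.inl (by rw [e]; ring)⟩
    · have h3 := h1 (by omega)
      have hak : a = k + 1 := by
        by_contra hne
        have : (k : ℝ) + 2 ≤ a := by exact_mod_cast (show k + 2 ≤ a by omega)
        linarith
      rw [hak] at e
      push_cast at e
      exact ⟨w', hw', abs_lt.2 ⟨by linarith, h3⟩, Or.inr (by rw [e]; ring)⟩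
  have hno : ∀ w ∈ D, |w| < r → ∀ w' ∈ D, |w'| < r → q * w = 1 / 2 + w' →
      ∃ w'' ∈ D, |w''| < r ∧ q * w' = -1 / 2 + w'' := by
    intro w hw hwr w' hw' hwr' e
    obtain ⟨w'', hw'', hwr'', e' | e'⟩ := hstep w' hw' hwr'
    · exfalso
      rw [abs_lt] at hwr hwr''
      have : q ^ 2 * w = (q + 1) / 2 + w'' := by linear_combination q * e + e'
      have : q ^ 2 * w < q ^ 2 * r := by
        have : 0 < q ^ 2 := by positivity
        nlinarith
      linarith
    · exact ⟨w'', hw'', hwr'', e'⟩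
  have main : ∀ w ∈ D, |w| < r → (∃ w' ∈ D, |w'| < r ∧ q * w = 1 / 2 + w') →
      w = 1 / (2 * (q + 1)) := by
    intro w hw hwr hstep'
    have hiter : ∀ n : ℕ, ∃ v ∈ D, |v| < r ∧ (∃ v' ∈ D, |v'| < r ∧ q * v = 1 / 2 + v') ∧
        q ^ n * |w - 1 / (2 * (q + 1))| = |v - 1 / (2 * (q + 1))| := by
      intro n
      induction n with
      | zero => exact ⟨w, hw, hwr, hstep', by simp⟩
      | succ n ih =>
        obtain ⟨v, hv, hvr, ⟨v', hv', hvr', e⟩, eq⟩ := ih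
        obtain ⟨v'', hv'', hvr'', e'⟩ := hno v hv hvr v' hv' hvr' e
        refine ⟨-v', hD.neg_mem _ hv', by rwa [abs_neg], ⟨-v'', hD.neg_mem _ hv'',
          by rwa [abs_neg], by rw [mul_neg, e']; ring⟩, ?_⟩
        have : -v' - 1 / (2 * (q + 1)) = -(q * (v - 1 / (2 * (q + 1)))) := by
          rw [mul_sub, e]
          field_simp
          ring
        rw [this, abs_neg, abs_mul, abs_of_pos (by linarith : 0 < q), pow_succ', mul_assoc, eq]
    have hp : 0 < 1 / (2 * (q + 1)) := by positivity
    have := eq_zero_of_pow_mul_abs_le hq (B := r + 1 / (2 * (q + 1))) (x := w - 1 / (2 * (q + 1)))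
      fun n => by
        obtain ⟨v, -, hvr, -, e⟩ := hiter n
        rw [e]
        rw [abs_lt] at hvr
        exact abs_le.2 ⟨by linarith, by linarith⟩
    linarith
  obtain ⟨w', hw', hwr', e | e⟩ := hstep w hw hwr
  · exact ⟨1, by simp, main w hw hwr ⟨w', hw', hwr', e⟩⟩
  · refine ⟨-1, by simp, ?_⟩
    have := main (-w) (hD.neg_mem w hw) (by rwa [abs_neg])
      ⟨-w', hD.neg_mem _ hw', by rwa [abs_neg], by rw [mul_neg, e]; ring⟩
    rw [neg_div, ← this, neg_neg]

theorem odd_cases {k : ℕ} {q : ℝ} (hq : 1 < q) (hqk2 : q < k + 2)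
    (hlt : q ^ 3 - (k + 2) * q ^ 2 + q - (k + 1) < 0) {D : Set ℝ}
    (hD : IsOrbitSet (2 * k + 1) q D) {w₁ w₂ : ℝ}
    (h₁ : w₁ ∈ D) (h₂ : w₂ ∈ D) {g : ℕ} (hg : 1 ≤ g) (h : w₁ + w₂ = g) :
    q = (2 * k + 1 : ℕ) / g + 1 ∨
    (∃ H ≤ 2 * k, ∃ s ∈ ({-2, 0, 2} : Finset ℝ), q = (H : ℕ) + 1 + s / (2 * (q + 1))) ∨
    (∃ s ∈ ({1, -1} : Finset ℝ), q - (k + 1) - s / (2 * (q + 1)) ∈ terminalSet k q) ∨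
    q * (q - (k + 1) - 1 / (2 * (q + 1))) - (k + 1 / 2) ∈ terminalSet k q ∨
    q * (q * (q - (k + 1) - 1 / (2 * (q + 1))) - (k + 1 / 2)) - (k + 1 / 2) ∈ terminalSet k q := by
  rcases hD.eq_or_exists_survivor (by omega) hq h₁ h₂ hg h with e | ⟨rfl, hr, w₀, hw₀, hwr₀⟩
  · exact Or.inl e
  right
  have hk' : (0 : ℝ) ≤ k := by positivity
  have hq1 : 0 < q - 1 := by linarith
  have hsurv : ∀ w ∈ D, |w| < radius (2 * k + 1) q → ∃ s ∈ ({1, -1} : Finset ℝ),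
      w = s / (2 * (q + 1)) := fun w hw hwr => odd_survivor hq hr hqk2 hlt hD hw hwr
  set r := radius (2 * k + 1) q with hrdef
  set p := 1 / (2 * (q + 1)) with hpdef
  have hp : 0 < p := by positivity
  have hpq : p * (q + 1) = 1 / 2 := by rw [hpdef]; field_simp
  have hpr : p < r := by
    obtain ⟨s, hs, e⟩ := hsurv w₀ hw₀ hwr₀
    have : |w₀| = p := by
      simp only [Finset.mem_insert, Finset.mem_singleton] at hs
      rcases hs with rfl | rfl
      · rw [e, abs_of_pos hp]
      · rw [e, neg_div, abs_neg, abs_of_pos hp]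
    rwa [this] at hwr₀
  have hS : ((2 * k + 1 : ℕ) : ℝ) / (2 * (q - 1)) = 1 - r := by rw [hrdef, radius]; ring
  have hrq : r * (q - 1) = q - 1 - (k + 1 / 2) := by
    rw [hrdef, radius]
    push_cast
    field_simp
  have hr2 : r < 1 / 2 := by nlinarith
  have hb : ∀ w ∈ D, |w| ≤ 1 - r := fun w hw => hS ▸ hD.abs_mem_le w hw
  have hG : 0 < q ^ 2 - (k + 1) * q - (k + 1) := by nlinarith
  have hcases : ∀ w ∈ D, r ≤ w → w ∈ terminalSet k q ∨
      ∃ w' ∈ D, r ≤ w' ∧ q * w = k + 1 / 2 + w' := by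
    intro w hw hwr
    obtain ⟨a, ha, w', hw', e, h1, h2⟩ := hD.step w hw
    push_cast at e
    have hqw : r < q * w := by nlinarith
    have fin : |w'| < r → a ≤ k → w ∈ terminalSet k q := by
      intro hr' hak
      obtain ⟨s, hs, es⟩ := hsurv w' hw' hr'
      refine ⟨k - a, by omega, s, hs, ?_⟩
      rw [e, ← es]
      push_cast [Nat.cast_sub hak]
      ring
    rcases Nat.eq_zero_or_pos a with rfl | ha0
    · have h3 := h2 (by omega)
      rcases lt_or_ge w' r with h4 | h4
      · exact Or.inl (fin (abs_lt.2 ⟨h3, h4⟩) (by omega))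
      · exact Or.inr ⟨w', hw', h4, by rw [e]; push_cast; ring⟩
    · left
      have h3 := h1 ha0
      by_cases hak : a ≤ k
      · exact fin (abs_lt.2 ⟨h2 (by omega), h3⟩) hak
      · exfalso
        have c' : (k : ℝ) + 1 ≤ a := by exact_mod_cast (not_le.1 hak)
        linarith
  have hmix : ∀ w₁ ∈ D, ∀ w₂ ∈ D, r ≤ w₂ → w₂ ∈ terminalSet k q →
      ∀ w' ∈ D, r ≤ w' → q * w₁ = k + 1 / 2 + w' → w₁ + w₂ = 1 →
      (∃ s ∈ ({1, -1} : Finset ℝ), q - (k + 1) - s / (2 * (q + 1)) ∈ terminalSet k q) ∨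
      q * (q - (k + 1) - p) - (k + 1 / 2) ∈ terminalSet k q ∨
      q * (q * (q - (k + 1) - p) - (k + 1 / 2)) - (k + 1 / 2) ∈ terminalSet k q := by
    intro w₁ _ w₂ _ _ ⟨H, hH, s, hs, e₂⟩ w' hw' hr' e₁ h
    have e : q = k + 1 / 2 + w' + (H + 1 / 2 + s / (2 * (q + 1))) := by
      rw [← e₁, ← e₂, ← mul_add, h, mul_one]
    have hs1 : s / (2 * (q + 1)) = p ∨ s / (2 * (q + 1)) = -p := by
      simp only [Finset.mem_insert, Finset.mem_singleton] at hs
      rcases hs with rfl | rfl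
      · exact Or.inl rfl
      · exact Or.inr (by rw [hpdef, neg_div])
    have hH0 : H = 0 := by
      by_contra hne
      have : (1 : ℝ) ≤ H := by exact_mod_cast (show 1 ≤ H by omega)
      rcases hs1 with e' | e' <;> rw [e'] at e <;> linarith
    rw [hH0, Nat.cast_zero] at e
    have ew : w' = q - (k + 1) - s / (2 * (q + 1)) := by linarith
    rcases hcases w' hw' hr' with t | ⟨w'', hw'', hr'', ei⟩
    · exact Or.inl ⟨s, hs, ew ▸ t⟩
    right
    rcases hs1 with e' | e'
    · rw [e'] at ew
      have ew' : w'' = q * (q - (k + 1) - p) - (k + 1 / 2) := by rw [← ew, ei]; ring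
      rcases hcases w'' hw'' hr'' with t | ⟨w₃, hw₃, hr₃, e₃⟩
      · exact Or.inl (ew' ▸ t)
      right
      have ew₃ : w₃ = q * (q * (q - (k + 1) - p) - (k + 1 / 2)) - (k + 1 / 2) := by
        rw [← ew', e₃]
        ring
      rcases hcases w₃ hw₃ hr₃ with t | ⟨w₄, hw₄, hr₄, e₄⟩
      · exact ew₃ ▸ t
      exfalso
      have ew₄ : w₄ - p = (q + 1) * (q ^ 3 - (k + 2) * q ^ 2 + q - (k + 1)) := by
        rw [ew₃] at e₄
        linear_combination -e₄ - (q ^ 2 - q + 1) * hpq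
      nlinarith
    · exfalso
      rw [e'] at ew
      have hle := (abs_le.1 (hb w' hw')).2
      nlinarith
  rw [Nat.cast_one] at h
  have hr₁ : r ≤ w₁ := by linarith [(abs_le.1 (hb w₂ h₂)).2]
  have hr₂ : r ≤ w₂ := by linarith [(abs_le.1 (hb w₁ h₁)).2]
  rcases hcases w₁ h₁ hr₁ with t₁ | ⟨w₁', h₁', hr₁', e₁⟩ <;>
    rcases hcases w₂ h₂ hr₂ with t₂ | ⟨w₂', h₂', hr₂', e₂⟩
  · left
    obtain ⟨H₁, hH₁, s₁, hs₁, e₁⟩ := t₁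
    obtain ⟨H₂, hH₂, s₂, hs₂, e₂⟩ := t₂
    refine ⟨H₁ + H₂, by omega, s₁ + s₂, ?_, ?_⟩
    · simp only [Finset.mem_insert, Finset.mem_singleton] at hs₁ hs₂ ⊢
      rcases hs₁ with rfl | rfl <;> rcases hs₂ with rfl | rfl <;> norm_num
    · push_cast
      linear_combination e₁ + e₂ - q * h
  · exact Or.inr (hmix w₂ h₂ w₁ h₁ hr₁ t₁ w₂' h₂' hr₂' e₂ (by linarith))
  · exact Or.inr (hmix w₁ h₁ w₂ h₂ hr₂ t₂ w₁' h₁' hr₁' e₁ h)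
  · exfalso
    have e : q = 2 * k + 1 + w₁' + w₂' := by linear_combination e₁ + e₂ - q * h
    have hk0 : k = 0 := by
      by_contra hne
      have : (1 : ℝ) ≤ k := by exact_mod_cast (show 1 ≤ k by omega)
      linarith
    subst hk0
    push_cast at *
    have hge : ∀ w ∈ D, r ≤ w → 1 / 2 + p ≤ q * w := by
      intro w hw hwr
      rcases hcases w hw hwr with ⟨H, -, s, hs, e⟩ | ⟨w', -, hr', e⟩
      · have hH : (0 : ℝ) ≤ H := by positivity
        simp only [Finset.mem_insert, Finset.mem_singleton] at hs
        rcases hs with rfl | rfl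
        · rw [e, ← hpdef]
          linarith
        · rw [neg_div, ← hpdef] at e
          rcases Nat.eq_zero_or_pos H with rfl | hH'
          · exfalso
            push_cast at e
            nlinarith
          · have : (1 : ℝ) ≤ H := by exact_mod_cast hH'
            nlinarith
      · linarith
    have g₁ := hge w₁' h₁' hr₁'
    have g₂ := hge w₂' h₂' hr₂'
    have e2 : q * q = q + q * w₁' + q * w₂' := by linear_combination q * e
    have g : 1 + 2 * p ≤ q * q - q := by linarith
    have g' : 2 * q + 2 ≤ q ^ 3 := by
      have := mul_le_mul_of_nonneg_right g (by linarith : (0 : ℝ) ≤ q + 1)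
      linear_combination this - 2 * hpq
    have g'' : 16 / 9 ≤ q := by
      by_contra! hc
      clear * - hq g' hlt hc
      nlinarith
    clear * - hlt g''
    nlinarith [sq_nonneg (q - 16 / 9)]

theorem finite_quintic_roots (a b c d e : ℝ) :
    {x : ℝ | x ^ 5 + a * x ^ 4 + b * x ^ 3 + c * x ^ 2 + d * x + e = 0}.Finite := by
  open Polynomial in
  let P : ℝ[X] := X ^ 5 + C a * X ^ 4 + C b * X ^ 3 + C c * X ^ 2 + C d * X + C e
  have hP : P.Monic := by
    simp only [P]
    monicity!
  refine (P.rootSet_finite ℝ).subset fun x hx => ?_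
  rw [Polynomial.mem_rootSet]
  refine ⟨hP.ne_zero, ?_⟩
  simpa [P] using hx

theorem finite_even_bases (k : ℕ) :
    {q : ℝ | ∃ j ≤ k, q ^ 2 - (k + 1) * q = (j : ℕ)}.Finite := by
  have : {q : ℝ | ∃ j ≤ k, q ^ 2 - (k + 1) * q = (j : ℕ)} ⊆ ⋃ j ∈ Finset.range (k + 1),
      {x : ℝ | x ^ 5 + (-(k + 1)) * x ^ 4 + (-j) * x ^ 3 + 0 * x ^ 2 + 0 * x + 0 = 0} := by
    rintro q ⟨j, hj, e⟩
    simp only [Set.mem_iUnion, Set.mem_ofPred_eq]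
    exact ⟨j, Finset.mem_range.2 (by omega), by linear_combination q ^ 3 * e⟩
  exact (Set.Finite.biUnion (Finset.finite_toSet _) fun j _ => finite_quintic_roots _ _ _ _ _).subset
    this

theorem finite_div_bases (m : ℕ) :
    {q : ℝ | ∃ g : ℕ, g ≤ m ∧ q = m / g + 1}.Finite := by
  refine ((Finset.range (m + 1)).finite_toSet.image fun g : ℕ => (m : ℝ) / g + 1).subset ?_
  rintro q ⟨g, hg, rfl⟩
  exact ⟨g, Finset.mem_coe.2 (Finset.mem_range.2 (by omega)), rfl⟩

theorem finite_cast_bases (m : ℕ) : {q : ℝ | ∃ n ≤ m, q = (n : ℕ)}.Finite := by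
  refine ((Finset.range (m + 1)).finite_toSet.image fun g : ℕ => (g : ℝ)).subset ?_
  rintro q ⟨g, hg, rfl⟩
  exact ⟨g, Finset.mem_coe.2 (Finset.mem_range.2 (by omega)), rfl⟩

theorem finite_of_quintic {ι : Type*} (I : Finset ι) (S : Set ℝ) (a b c d e : ι → ℝ)
    (h : ∀ q ∈ S, ∃ i ∈ I,
      q ^ 5 + a i * q ^ 4 + b i * q ^ 3 + c i * q ^ 2 + d i * q + e i = 0) : S.Finite := by
  refine (Set.Finite.biUnion (Finset.finite_toSet I) fun i _ =>
    finite_quintic_roots (a i) (b i) (c i) (d i) (e i)).subset fun q hq => ?_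
  obtain ⟨i, hi, e⟩ := h q hq
  simp only [Set.mem_iUnion]
  exact ⟨i, hi, e⟩

theorem finite_odd_bases_sum (k : ℕ) : {q : ℝ | 1 < q ∧ ∃ H ≤ 2 * k,
    ∃ s ∈ ({-2, 0, 2} : Finset ℝ), q = (H : ℕ) + 1 + s / (2 * (q + 1))}.Finite := by
  refine finite_of_quintic (Finset.range (2 * k + 1) ×ˢ ({-2, 0, 2} : Finset ℝ)) _
    (fun i => 1 - (i.1 + 1)) (fun i => -(i.1 + 1) - i.2 / 2) (fun _ => 0) (fun _ => 0)
    (fun _ => 0) ?_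
  rintro q ⟨hq, H, hH, s, hs, e⟩
  refine ⟨(H, s), Finset.mem_product.2 ⟨Finset.mem_range.2 (by omega), hs⟩, ?_⟩
  have h2 : s / (2 * (q + 1)) * (q + 1) = s / 2 := by
    field_simp
  simp only
  linear_combination q ^ 3 * (q + 1) * e + q ^ 3 * h2

theorem finite_odd_bases_one (k : ℕ) : {q : ℝ | 1 < q ∧ ∃ s ∈ ({1, -1} : Finset ℝ),
    q - (k + 1) - s / (2 * (q + 1)) ∈ terminalSet k q}.Finite := by
  refine finite_of_quintic (Finset.range (k + 1) ×ˢ (({1, -1} : Finset ℝ) ×ˢ ({1, -1} : Finset ℝ)))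
    _ (fun _ => -k) (fun i => -(k + 1) - i.2.1 / 2 - (i.1 + 1 / 2))
    (fun i => -(i.1 + 1 / 2) - i.2.2 / 2) (fun _ => 0) (fun _ => 0) ?_
  rintro q ⟨hq, s, hs, H, hH, s', hs', e⟩
  refine ⟨(H, s, s'), Finset.mem_product.2 ⟨Finset.mem_range.2 (by omega),
    Finset.mem_product.2 ⟨hs, hs'⟩⟩, ?_⟩
  have h1 : s / (2 * (q + 1)) * (q + 1) = s / 2 := by
    field_simp
  have h2 : s' / (2 * (q + 1)) * (q + 1) = s' / 2 := by
    field_simp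
  simp only
  linear_combination q ^ 2 * (q + 1) * e + q ^ 2 * h2 + q ^ 3 * h1

theorem finite_odd_bases_two (k : ℕ) : {q : ℝ | 1 < q ∧
    q * (q - (k + 1) - 1 / (2 * (q + 1))) - (k + 1 / 2) ∈ terminalSet k q}.Finite := by
  refine finite_of_quintic (Finset.range (k + 1) ×ˢ ({1, -1} : Finset ℝ)) _ (fun _ => -k)
    (fun _ => -(k + 1) - 1 / 2 - (k + 1 / 2)) (fun i => -(k + 1 / 2) - (i.1 + 1 / 2))
    (fun i => -(i.1 + 1 / 2) - i.2 / 2) (fun _ => 0) ?_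
  rintro q ⟨hq, H, hH, s, hs, e⟩
  refine ⟨(H, s), Finset.mem_product.2 ⟨Finset.mem_range.2 (by omega), hs⟩, ?_⟩
  have h1 : 1 / (2 * (q + 1)) * (q + 1) = 1 / 2 := by
    field_simp
  have h2 : s / (2 * (q + 1)) * (q + 1) = s / 2 := by
    field_simp
  simp only
  linear_combination q * (q + 1) * e + q * h2 + q ^ 3 * h1

theorem finite_odd_bases_three (k : ℕ) : {q : ℝ | 1 < q ∧
    q * (q * (q - (k + 1) - 1 / (2 * (q + 1))) - (k + 1 / 2)) - (k + 1 / 2) ∈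
      terminalSet k q}.Finite := by
  refine finite_of_quintic (Finset.range (k + 1) ×ˢ ({1, -1} : Finset ℝ)) _ (fun _ => -k)
    (fun _ => -(k + 1) - 1 / 2 - (k + 1 / 2)) (fun _ => -(k + 1 / 2) - (k + 1 / 2))
    (fun i => -(k + 1 / 2) - (i.1 + 1 / 2)) (fun i => -(i.1 + 1 / 2) - i.2 / 2) ?_
  rintro q ⟨hq, H, hH, s, hs, e⟩
  refine ⟨(H, s), Finset.mem_product.2 ⟨Finset.mem_range.2 (by omega), hs⟩, ?_⟩
  have h1 : 1 / (2 * (q + 1)) * (q + 1) = 1 / 2 := by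
    field_simp
  have h2 : s / (2 * (q + 1)) * (q + 1) = s / 2 := by
    field_simp
  simp only
  linear_combination (q + 1) * e + h2 + q ^ 3 * h1

theorem isQf_le_two_add {k : ℕ} {x : ℝ}
    (h : x ^ 3 - ((k : ℝ) + 2) * x ^ 2 + x - ((k : ℝ) + 1) = 0) : x < k + 2 := by
  nlinarith [sq_nonneg x]

theorem odd_poly_neg {k : ℕ} {x q : ℝ}
    (h : x ^ 3 - ((k : ℝ) + 2) * x ^ 2 + x - ((k : ℝ) + 1) = 0) (hq : 1 < q) (hqx : q < x) :
    q ^ 3 - (k + 2) * q ^ 2 + q - (k + 1) < 0 := by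
  have hx := isQf_le_two_add h
  have hk : (0 : ℝ) ≤ k := by positivity
  rcases le_or_gt q (k + 1) with hc | hc
  · nlinarith [sq_nonneg q]
  · have e : q ^ 3 - (k + 2) * q ^ 2 + q - (k + 1) =
        (q - x) * (q ^ 2 + q * x + x ^ 2 - (k + 2) * (q + x) + 1) := by
      linear_combination h
    rw [e]
    refine mul_neg_of_neg_of_pos (by linarith) ?_
    nlinarith [mul_pos (sub_pos.2 hc) (sub_pos.2 (hc.trans hqx)), sq_nonneg (k : ℝ)]

theorem finite_B2_inter_Iio {m : ℕ} (hm : 0 < m) {qf : ℝ} (hqf : isQf m qf) :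
    (B2 m ∩ Set.Iio qf).Finite := by
  rcases hqf with ⟨k, rfl, h, -⟩ | ⟨k, rfl, h, hmax⟩
  · refine ((finite_div_bases (2 * k + 1)).union ((finite_odd_bases_sum k).union
      ((finite_odd_bases_one k).union ((finite_odd_bases_two k).union
        (finite_odd_bases_three k))))).subset ?_
    rintro q ⟨hqB, hqlt⟩
    obtain ⟨c, hc, d, hd, g, hg, hgm, e⟩ := exists_of_mem_B2 hqB
    have hq := hqB.1.1
    have hlt : q < qf := hqlt
    rcases odd_cases hq (hlt.trans (isQf_le_two_add h)) (odd_poly_neg h hq hlt)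
      (isOrbitSet_centreDev hq hqB.1.2) ⟨c, hc, Or.inl rfl⟩ ⟨d, hd, Or.inr rfl⟩ hg
      (by rw [← e]; ring) with h | h | h | h | h
    · exact Or.inl ⟨g, hgm, h⟩
    · exact Or.inr (Or.inl ⟨hq, h⟩)
    · exact Or.inr (Or.inr (Or.inl ⟨hq, h⟩))
    · exact Or.inr (Or.inr (Or.inr (Or.inl ⟨hq, h⟩)))
    · exact Or.inr (Or.inr (Or.inr (Or.inr ⟨hq, h⟩)))
  · refine ((finite_div_bases (2 * k)).union ((finite_cast_bases (2 * k)).union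
      (finite_even_bases k))).subset ?_
    rintro q ⟨hqB, hqlt⟩
    obtain ⟨c, hc, d, hd, g, hg, hgm, e⟩ := exists_of_mem_B2 hqB
    have hq := hqB.1.1
    have hlt : q < qf := hqlt
    have hk : (0 : ℝ) ≤ k := by positivity
    have hneg : q ^ 2 - (k + 1) * q - k < 0 := by
      have : q ^ 2 - (k + 1) * q - k = (q - qf) * (q + qf - (k + 1)) := by linear_combination h
      rw [this]
      refine mul_neg_of_neg_of_pos (by linarith) ?_
      nlinarith
    rcases even_trichotomy (by omega) hq hneg
      (isOrbitSet_centreDev hq hqB.1.2) ⟨c, hc, Or.inl rfl⟩ ⟨d, hd, Or.inr rfl⟩ hg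
      (by rw [← e]; ring) with h | h | h
    · exact Or.inl ⟨g, hgm, h⟩
    · exact Or.inr (Or.inl h)
    · exact Or.inr (Or.inr h)

/-- Solutions of `G + e n = 1` accumulate at the solution of `G = 1`. -/
theorem mem_accPts_of_perturbation {S : Set ℝ} {x B : ℝ} (hxB : x < B) {G : ℝ → ℝ}
    {e : ℕ → ℝ → ℝ} (hG : ContinuousOn G (Set.Icc x B)) (hanti : StrictAntiOn G (Set.Icc x B))
    (hx : G x = 1) (he : ∀ n, ContinuousOn (e n) (Set.Icc x B)) (hpos : ∀ n, 0 < e n x)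
    (hlim : ∀ y ∈ Set.Ioo x B, Filter.Tendsto (fun n => e n y) Filter.atTop (nhds 0))
    (hS : ∀ n, ∀ q ∈ Set.Ioo x B, G q + e n q = 1 → q ∈ S) : x ∈ accPts S := by
  refine accPt_iff_nhds.2 fun U hU => ?_
  obtain ⟨ε, hε, hball⟩ := Metric.mem_nhds_iff.1 hU
  obtain ⟨y, hxy, hy⟩ := exists_between (lt_min (show x < x + ε by linarith) hxB)
  obtain ⟨hyε, hyB⟩ := lt_min_iff.1 hy
  have hGy : G y < 1 := hx ▸ hanti ⟨le_rfl, hxB.le⟩ ⟨hxy.le, hyB.le⟩ hxy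
  obtain ⟨n, hn⟩ := ((hlim y ⟨hxy, hyB⟩).eventually_lt_const (sub_pos.2 hGy)).exists
  have hsub : Set.Icc x y ⊆ Set.Icc x B := Set.Icc_subset_Icc_right hyB.le
  have hcont : ContinuousOn (fun q => G q + e n q) (Set.Icc x y) :=
    (hG.mono hsub).add ((he n).mono hsub)
  obtain ⟨q, hq, hq1⟩ := intermediate_value_Ioo' hxy.le hcont
    (show (1 : ℝ) ∈ Set.Ioo _ _ from ⟨by linarith, by linarith [hpos n]⟩)
  refine ⟨q, ⟨hball ?_, hS n q ⟨hq.1, hq.2.trans hyB⟩ hq1⟩, hq.1.ne'⟩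
  rw [Metric.mem_ball, Real.dist_eq, abs_of_pos (by linarith [hq.1])]
  linarith [hq.2]

theorem mem_accPts_accPts {S : Set ℝ} {x B : ℝ} (hxB : x < B) {G : ℝ → ℝ}
    {e e' : ℕ → ℝ → ℝ} (hG : ContinuousOn G (Set.Icc x B)) (hanti : StrictAntiOn G (Set.Icc x B))
    (hx : G x = 1) (he : ∀ n, ContinuousOn (e n) (Set.Icc x B))
    (hpos : ∀ n, ∀ y ∈ Set.Icc x B, 0 < e n y) (heanti : ∀ n, AntitoneOn (e n) (Set.Icc x B))
    (hlim : ∀ y ∈ Set.Icc x B, Filter.Tendsto (fun n => e n y) Filter.atTop (nhds 0))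
    (he' : ∀ n, ContinuousOn (e' n) (Set.Icc x B))
    (hpos' : ∀ n, ∀ y ∈ Set.Icc x B, 0 < e' n y)
    (hlim' : ∀ y ∈ Set.Icc x B, Filter.Tendsto (fun n => e' n y) Filter.atTop (nhds 0))
    (hS : ∀ i j, ∀ q ∈ Set.Ioo x B, G q + e i q + e' j q = 1 → q ∈ S) :
    x ∈ accPts (accPts S) := by
  refine mem_accPts_of_perturbation hxB hG hanti hx he (fun n => hpos n x ⟨le_rfl, hxB.le⟩)
    (fun y hy => hlim y ⟨hy.1.le, hy.2.le⟩) fun i y hy hy1 => ?_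
  have hsub : Set.Icc y B ⊆ Set.Icc x B := Set.Icc_subset_Icc_left hy.1.le
  refine mem_accPts_of_perturbation (G := fun q => G q + e i q) hy.2
    ((hG.add (he i)).mono hsub) ((hanti.mono hsub).add_antitone ((heanti i).mono hsub)) hy1
    (fun n => (he' n).mono hsub) (fun n => hpos' n y ⟨hy.1.le, hy.2.le⟩)
    (fun z hz => hlim' z ⟨(hy.1.trans hz.1).le, hz.2.le⟩)
    (fun j q hq => hS i j q ⟨hy.1.trans hq.1, hq.2⟩)

theorem accPts_subset_Ici {S : Set ℝ} {x : ℝ} (h : (S ∩ Set.Iio x).Finite) :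
    accPts S ⊆ Set.Ici x := by
  intro y hy
  by_contra hyx
  have hyx : y < x := not_le.1 hyx
  have hfin : ((S ∩ Set.Iio x) \ {y}).Finite := h.subset Set.sdiff_subset
  obtain ⟨z, ⟨⟨hz, hz'⟩, hzS⟩, hne⟩ := accPt_iff_nhds.1 hy (Set.Iio x ∩ ((S ∩ Set.Iio x) \ {y})ᶜ)
    (Filter.inter_mem (Iio_mem_nhds hyx) (hfin.isClosed.isOpen_compl.mem_nhds (by simp)))
  exact hz' ⟨⟨hzS, hz⟩, hne⟩

theorem isLeast_of_mem_accPts_accPts {S : Set ℝ} {x : ℝ} (h : (S ∩ Set.Iio x).Finite)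
    (hx : x ∈ accPts (accPts S)) : IsLeast (accPts S) x ∧ IsLeast (accPts (accPts S)) x := by
  have hsub : accPts (accPts S) ⊆ accPts S :=
    (isClosed_iff_derivedSet_subset _).1 (isClosed_derivedSet S)
  exact ⟨⟨hsub hx, accPts_subset_Ici h⟩, ⟨hx, fun y hy => accPts_subset_Ici h (hsub hy)⟩⟩

theorem centreDev_cons {m : ℕ} {q : ℝ} (hq : 1 < q) {a : ℕ} (ha : a ≤ m) {c : ℕ → ℕ}
    (hc : ∀ i, c i ≤ m) : centreDev m q (digitCons a c) = (m / 2 - a + centreDev m q c) / q := by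
  have h0 : q ≠ 0 := by linarith
  have := mul_centreDev (m := m) (c := digitCons a c) hq (by
    rintro (_ | i)
    exacts [ha, hc i])
  rw [eq_div_iff h0, mul_comm, this]
  rfl

theorem centreDev_reflect {m : ℕ} {q : ℝ} (hq : 1 < q) {c : ℕ → ℕ} (hc : ∀ i, c i ≤ m) :
    centreDev m q (fun i => m - c i) = -centreDev m q c := by
  have h : digitVal q (fun i => m - c i) = m / (q - 1) - digitVal q c := by
    have e : (fun i => ((m - c i : ℕ) : ℝ) / q ^ (i + 1)) =
        fun i => (m : ℝ) / q ^ (i + 1) - (c i : ℝ) / q ^ (i + 1) := by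
      ext i
      rw [Nat.cast_sub (hc i), sub_div]
    rw [digitVal, e]
    exact ((hasSum_const_digit hq m).sub (summable_digits hq hc).hasSum).tsum_eq
  rw [centreDev, centreDev, h, half_add_half]
  ring

theorem Admissible.reflect {m : ℕ} {q : ℝ} (hq : 1 < q) {c : ℕ → ℕ} (hc : Admissible m q c) :
    Admissible m q (fun i => m - c i) := by
  intro n
  have hm : ∀ i, c i ≤ m := fun i => (hc i).1
  obtain ⟨h, h1, h2⟩ := hc n
  have e := centreDev_reflect hq (fun i => hm (i + (n + 1)))
  refine ⟨Nat.sub_le _ _, fun hp => ?_, fun hp => ?_⟩ <;> rw [e]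
  · have hp' : 0 < m - c n := hp
    linarith [h2 (by omega)]
  · have hp' : m - c n < m := hp
    linarith [h1 (by omega)]

theorem Admissible.cons_of_abs_lt {m : ℕ} {q : ℝ} {c : ℕ → ℕ} (hc : Admissible m q c) {a : ℕ}
    (ha : a ≤ m) (h : |centreDev m q c| < radius m q) : Admissible m q (digitCons a c) :=
  hc.cons ha (fun _ => (abs_lt.1 h).2) fun _ => (abs_lt.1 h).1

theorem Admissible.zero_cons {m : ℕ} {q : ℝ} (hq : 1 < q) {c : ℕ → ℕ} (hc : Admissible m q c)
    (hr : 0 < radius m q) (h : 0 < centreDev m q c) :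
    Admissible m q (digitCons 0 c) ∧ 0 < centreDev m q (digitCons 0 c) ∧
      centreDev m q (digitCons 0 c) = (m / 2 + centreDev m q c) / q := by
  have e := centreDev_cons hq (Nat.zero_le m) (fun i => (hc i).1)
  rw [Nat.cast_zero, sub_zero] at e
  refine ⟨hc.cons (Nat.zero_le m) (fun h => absurd h (lt_irrefl 0)) (fun _ => by linarith), ?_, e⟩
  rw [e]
  have : 0 < q := by linarith
  positivity

/-- The periodic digit sequence with period `a b c d`. -/
def periodFour (a b c d : ℕ) (n : ℕ) : ℕ :=
  if n % 4 = 0 then a else if n % 4 = 1 then b else if n % 4 = 2 then c else d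

theorem periodFour_shift (a b c d : ℕ) :
    (fun i => periodFour a b c d (i + 1)) = periodFour b c d a := by
  ext i
  simp only [periodFour]
  have : i % 4 < 4 := Nat.mod_lt _ (by norm_num)
  grind

theorem periodFour_le {m a b c d : ℕ} (ha : a ≤ m) (hb : b ≤ m) (hc : c ≤ m) (hd : d ≤ m) (i : ℕ) :
    periodFour a b c d i ≤ m := by
  rw [periodFour]
  split_ifs <;> assumption

theorem centreDev_periodFour {m a b c d : ℕ} {q : ℝ} (hq : 1 < q) (ha : a ≤ m) (hb : b ≤ m)
    (hc : c ≤ m) (hd : d ≤ m) {x y z w : ℝ} (hx : q * x = m / 2 - a + y)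
    (hy : q * y = m / 2 - b + z) (hz : q * z = m / 2 - c + w) (hw : q * w = m / 2 - d + x) :
    centreDev m q (periodFour a b c d) = x := by
  have e1 := mul_centreDev hq (periodFour_le ha hb hc hd)
  have e2 := mul_centreDev hq (periodFour_le hb hc hd ha)
  have e3 := mul_centreDev hq (periodFour_le hc hd ha hb)
  have e4 := mul_centreDev hq (periodFour_le hd ha hb hc)
  have head : ∀ a b c d, periodFour a b c d 0 = a := fun _ _ _ _ => rfl
  rw [periodFour_shift, head] at e1 e2 e3 e4
  have key : (q ^ 4 - 1) * (centreDev m q (periodFour a b c d) - x) = 0 := by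
    linear_combination q ^ 3 * (e1 - hx) + q ^ 2 * (e2 - hy) + q * (e3 - hz) + (e4 - hw)
  have h4 : 1 < q ^ 4 := one_lt_pow₀ hq (by norm_num)
  rcases mul_eq_zero.1 key with h | h <;> linarith

theorem admissible_periodFour {m a b c d : ℕ} {q : ℝ} (ha : a ≤ m) (hb : b ≤ m)
    (hc : c ≤ m) (hd : d ≤ m) (h1 : |centreDev m q (periodFour a b c d)| < radius m q)
    (h2 : |centreDev m q (periodFour b c d a)| < radius m q)
    (h3 : |centreDev m q (periodFour c d a b)| < radius m q)
    (h4 : |centreDev m q (periodFour d a b c)| < radius m q) :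
    Admissible m q (periodFour a b c d) := by
  have shift_add : ∀ n : ℕ, ∃ a' b' c' d', (fun i => periodFour a b c d (i + n)) =
      periodFour a' b' c' d' ∧ |centreDev m q (periodFour a' b' c' d')| < radius m q ∧
      |centreDev m q (periodFour b' c' d' a')| < radius m q ∧
      |centreDev m q (periodFour c' d' a' b')| < radius m q ∧
      |centreDev m q (periodFour d' a' b' c')| < radius m q := by
    intro n
    induction n with
    | zero => exact ⟨a, b, c, d, rfl, h1, h2, h3, h4⟩
    | succ n ih =>
      obtain ⟨a', b', c', d', e, h1, h2, h3, h4⟩ := ih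
      refine ⟨b', c', d', a', ?_, h2, h3, h4, h1⟩
      rw [← periodFour_shift a' b' c' d', ← e]
      ext i
      congr 1
      ring
  intro n
  obtain ⟨a', b', c', d', e, h, -⟩ := shift_add (n + 1)
  rw [e]
  rw [abs_lt] at h
  exact ⟨periodFour_le ha hb hc hd n, fun _ => h.2, fun _ => h.1⟩

theorem exists_even_tail {k : ℕ} (hk : 0 < k) {q : ℝ} (hq : 1 < q)
    (hr : 1 / (q + 1) < radius (2 * k) q) (i : ℕ) :
    ∃ c, Admissible (2 * k) q c ∧ centreDev (2 * k) q c = 1 / (q + 1) / q ^ i := by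
  have h0 : 0 < q := by linarith
  have hle : ∀ i : ℕ, |1 / (q + 1) / q ^ i| < radius (2 * k) q := by
    intro i
    rw [abs_of_pos (by positivity)]
    exact (div_le_self (by positivity) (one_le_pow₀ hq.le)).trans_lt hr
  induction i with
  | zero =>
    have hcast : ((k - 1 : ℕ) : ℝ) = k - 1 := by rw [Nat.cast_sub hk, Nat.cast_one]
    have e1 : q * (1 / (q + 1)) = 1 - 1 / (q + 1) := by field_simp; ring
    have d1 : centreDev (2 * k) q (periodFour (k - 1) (k + 1) (k - 1) (k + 1)) = 1 / (q + 1) :=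
      centreDev_periodFour (y := -(1 / (q + 1))) (z := 1 / (q + 1)) (w := -(1 / (q + 1))) hq
        (by omega) (by omega) (by omega) (by omega)
        (by rw [hcast]; push_cast; linear_combination e1)
        (by push_cast; linear_combination -e1)
        (by rw [hcast]; push_cast; linear_combination e1)
        (by push_cast; linear_combination -e1)
    have d2 : centreDev (2 * k) q (periodFour (k + 1) (k - 1) (k + 1) (k - 1)) = -(1 / (q + 1)) :=
      centreDev_periodFour (y := 1 / (q + 1)) (z := -(1 / (q + 1))) (w := 1 / (q + 1)) hq
        (by omega) (by omega) (by omega) (by omega)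
        (by push_cast; linear_combination -e1)
        (by rw [hcast]; push_cast; linear_combination e1)
        (by push_cast; linear_combination -e1)
        (by rw [hcast]; push_cast; linear_combination e1)
    have h := hle 0
    rw [pow_zero, div_one] at h
    have h' := h
    rw [← d1] at h
    rw [← abs_neg, ← d2] at h'
    exact ⟨_, admissible_periodFour (by omega) (by omega) (by omega) (by omega) h h' h h',
      by rw [d1, pow_zero, div_one]⟩
  | succ i ih =>
    obtain ⟨c, hc, e⟩ := ih
    refine ⟨digitCons k c, hc.cons_of_abs_lt (by omega) (e ▸ hle i), ?_⟩
    rw [centreDev_cons hq (by omega) (fun i => (hc i).1), e, pow_succ]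
    push_cast
    field_simp
    ring

theorem even_mem_B2 {k : ℕ} (hk : 0 < k) {q : ℝ} (hq : 1 < q) (hqm : q < k + 2)
    (hpos : 0 < q ^ 2 - (k + 1) * q - k) {i j : ℕ}
    (h : (k + 1) / q + k / q ^ 2 + 1 / (q + 1) / q ^ i / q ^ 2 + 1 / (q + 1) / q ^ j / q = 1) :
    q ∈ B2 (2 * k) := by
  have h0 : 0 < q := by linarith
  have hq1 : 0 < q - 1 := by linarith
  have hk' : (1 : ℝ) ≤ k := by exact_mod_cast hk
  have hr : 1 / (q + 1) < radius (2 * k) q := by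
    have : radius (2 * k) q = (q - 1 - k) / (q - 1) := by
      rw [radius]
      push_cast
      field_simp
    rw [this, div_lt_div_iff₀ (by linarith) hq1]
    linarith
  have hr0 : 0 < radius (2 * k) q := lt_trans (by positivity) hr
  obtain ⟨c, hc, ec⟩ := exists_even_tail hk hq hr i
  obtain ⟨d, hd, ed⟩ := exists_even_tail hk hq hr j
  obtain ⟨hc1, p1, e1⟩ := hc.zero_cons hq hr0 (by rw [ec]; positivity)
  obtain ⟨hc2, -, e2⟩ := hc1.zero_cons hq hr0 p1
  have hd1 := hd.reflect hq
  have ed1 := centreDev_reflect hq (fun i => (hd i).1)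
  have hle : |centreDev (2 * k) q (fun i => 2 * k - d i)| < radius (2 * k) q := by
    rw [ed1, abs_neg, ed, abs_of_pos (by positivity)]
    exact (div_le_self (by positivity) (one_le_pow₀ hq.le)).trans_lt hr
  have hd2 := hd1.cons_of_abs_lt (a := k + 1) (by omega) hle
  have ed2 := centreDev_cons hq (show k + 1 ≤ 2 * k by omega) (fun i => (hd1 i).1)
  refine mem_B2_of_admissible (by omega) hq (by push_cast; linarith) hr0 hc2 hd2 ?_
  refine Eq.trans ?_ h
  rw [e2, e1, ec, ed2, ed1, ed]
  push_cast
  generalize 1 / (q + 1) / q ^ i = u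
  generalize 1 / (q + 1) / q ^ j = v
  field_simp
  ring

theorem exists_odd_tail {k : ℕ} {q : ℝ} (hq : 1 < q)
    (hr : (q + 1) / (2 * (q ^ 2 + 1)) < radius (2 * k + 1) q) (n : ℕ) :
    ∃ c, Admissible (2 * k + 1) q c ∧ |centreDev (2 * k + 1) q c| < radius (2 * k + 1) q ∧
      centreDev (2 * k + 1) q c =
        1 / (2 * (q + 1)) + 1 / ((q + 1) * (q ^ 2 + 1)) / q ^ (2 * n + 1) := by
  have h0 : 0 < q := by linarith
  have hbound : 1 / (2 * (q + 1)) + 1 / ((q + 1) * (q ^ 2 + 1)) < radius (2 * k + 1) q := by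
    refine lt_of_le_of_lt ?_ hr
    rw [← sub_nonneg]
    have : (q + 1) / (2 * (q ^ 2 + 1)) - (1 / (2 * (q + 1)) + 1 / ((q + 1) * (q ^ 2 + 1))) =
        (q - 1) / ((q + 1) * (q ^ 2 + 1)) := by
      field_simp
      ring
    rw [this]
    exact div_nonneg (by linarith) (by positivity)
  have hp : 0 < 1 / (2 * (q + 1)) := by positivity
  have he : 0 < 1 / ((q + 1) * (q ^ 2 + 1)) := by positivity
  have hle : ∀ n : ℕ, 1 / ((q + 1) * (q ^ 2 + 1)) / q ^ n ≤ 1 / ((q + 1) * (q ^ 2 + 1)) :=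
    fun n => div_le_self he.le (one_le_pow₀ hq.le)
  have he' : ∀ n : ℕ, 0 < 1 / ((q + 1) * (q ^ 2 + 1)) / q ^ n := fun n => by positivity
  suffices h : ∃ c, Admissible (2 * k + 1) q c ∧ centreDev (2 * k + 1) q c =
      1 / (2 * (q + 1)) + 1 / ((q + 1) * (q ^ 2 + 1)) / q ^ (2 * n + 1) by
    obtain ⟨c, hc, e⟩ := h
    refine ⟨c, hc, ?_, e⟩
    rw [e, abs_of_pos (add_pos hp (he' _))]
    linarith [hle (2 * n + 1)]
  induction n with
  | zero =>
    set t := (q + 1) / (2 * (q ^ 2 + 1)) with ht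
    set t' := (q - 1) / (2 * (q ^ 2 + 1)) with ht'
    have ht0 : 0 < t := by positivity
    have ht0' : 0 < t' := div_pos (by linarith) (by positivity)
    have htt : t' < t := by
      rw [ht, ht']
      gcongr
      linarith
    have a1 : q * t = 1 / 2 + t' := by rw [ht, ht']; field_simp; ring
    have a2 : q * t' = 1 / 2 - t := by rw [ht, ht']; field_simp; ring
    have d1 : centreDev (2 * k + 1) q (periodFour (k + 1) k k (k + 1)) = -t' :=
      centreDev_periodFour (y := t) (z := t') (w := -t) hq
        (by omega) (by omega) (by omega) (by omega)
        (by push_cast; linear_combination -a2) (by push_cast; linear_combination a1)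
        (by push_cast; linear_combination a2) (by push_cast; linear_combination -a1)
    have d2 : centreDev (2 * k + 1) q (periodFour k k (k + 1) (k + 1)) = t :=
      centreDev_periodFour (y := t') (z := -t) (w := -t') hq
        (by omega) (by omega) (by omega) (by omega)
        (by push_cast; linear_combination a1) (by push_cast; linear_combination a2)
        (by push_cast; linear_combination -a1) (by push_cast; linear_combination -a2)
    have d3 : centreDev (2 * k + 1) q (periodFour k (k + 1) (k + 1) k) = t' :=
      centreDev_periodFour (y := -t) (z := -t') (w := t) hq
        (by omega) (by omega) (by omega) (by omega)
        (by push_cast; linear_combination a2) (by push_cast; linear_combination -a1)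
        (by push_cast; linear_combination -a2) (by push_cast; linear_combination a1)
    have d4 : centreDev (2 * k + 1) q (periodFour (k + 1) (k + 1) k k) = -t :=
      centreDev_periodFour (y := -t') (z := t) (w := t') hq
        (by omega) (by omega) (by omega) (by omega)
        (by push_cast; linear_combination -a1) (by push_cast; linear_combination -a2)
        (by push_cast; linear_combination a1) (by push_cast; linear_combination a2)
    have hc : Admissible (2 * k + 1) q (periodFour (k + 1) k k (k + 1)) := by
      refine admissible_periodFour (by omega) (by omega) (by omega) (by omega) ?_ ?_ ?_ ?_
      · rw [d1, abs_neg, abs_of_pos ht0']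
        linarith
      · rw [d2, abs_of_pos ht0]
        exact hr
      · rw [d3, abs_of_pos ht0']
        linarith
      · rw [d4, abs_neg, abs_of_pos ht0]
        exact hr
    refine ⟨digitCons k (periodFour (k + 1) k k (k + 1)), hc.cons_of_abs_lt (by omega) ?_, ?_⟩
    · rw [d1, abs_neg, abs_of_pos ht0']
      linarith
    · rw [centreDev_cons hq (by omega) (fun i => (hc i).1), d1, ht']
      push_cast
      field_simp
      ring
  | succ n ih =>
    obtain ⟨c, hc, e⟩ := ih
    have h1 := hc.cons_of_abs_lt (a := k + 1) (by omega) (by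
      rw [e, abs_of_pos (add_pos hp (he' _))]
      linarith [hle (2 * n + 1)])
    have e1 : centreDev (2 * k + 1) q (digitCons (k + 1) c) =
        -(1 / (2 * (q + 1))) + 1 / ((q + 1) * (q ^ 2 + 1)) / q ^ (2 * n + 2) := by
      rw [centreDev_cons hq (by omega) (fun i => (hc i).1), e]
      push_cast
      field_simp
      ring
    refine ⟨_, h1.cons_of_abs_lt (a := k) (by omega) ?_, ?_⟩
    · rw [e1, abs_lt]
      constructor <;> linarith [hle (2 * n + 2), he' (2 * n + 2)]
    · rw [centreDev_cons hq (by omega) (fun i => (h1 i).1), e1]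
      push_cast
      field_simp
      ring

theorem odd_mem_B2 {k : ℕ} {q : ℝ} (hq : 1 < q) (hqm : q < k + 2)
    (hpos : 0 < q ^ 3 - (k + 2) * q ^ 2 + q - (k + 1)) {i j : ℕ}
    (h : ((k + 1 / 2) / q + (k + 1 / 2) / q ^ 2 + (k + 1 / 2) / q ^ 3 + (k + 1 / 2) / q ^ 4 +
        1 / (2 * (q + 1)) / q ^ 4 + (1 / 2 + 1 / (2 * (q + 1))) / q) +
      1 / ((q + 1) * (q ^ 2 + 1)) / q ^ (2 * i + 1) / q ^ 4 +
      1 / ((q + 1) * (q ^ 2 + 1)) / q ^ (2 * j + 1) / q = 1) :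
    q ∈ B2 (2 * k + 1) := by
  have h0 : 0 < q := by linarith
  have hq1 : 0 < q - 1 := by linarith
  have hr : (q + 1) / (2 * (q ^ 2 + 1)) < radius (2 * k + 1) q := by
    have : radius (2 * k + 1) q = (2 * q - 2 * k - 3) / (2 * (q - 1)) := by
      rw [radius]
      push_cast
      field_simp
      ring
    rw [this, div_lt_div_iff₀ (by positivity) (by linarith)]
    linarith
  have hr0 : 0 < radius (2 * k + 1) q := lt_trans (by positivity) hr
  obtain ⟨c, hc, -, ec⟩ := exists_odd_tail hq hr i
  obtain ⟨d, hd, hle, ed⟩ := exists_odd_tail hq hr j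
  obtain ⟨hc1, p1, e1⟩ := hc.zero_cons hq hr0 (by rw [ec]; positivity)
  obtain ⟨hc2, p2, e2⟩ := hc1.zero_cons hq hr0 p1
  obtain ⟨hc3, p3, e3⟩ := hc2.zero_cons hq hr0 p2
  obtain ⟨hc4, -, e4⟩ := hc3.zero_cons hq hr0 p3
  have hd1 := hd.reflect hq
  have ed1 := centreDev_reflect hq (fun i => (hd i).1)
  have hd2 := hd1.cons_of_abs_lt (a := k + 1) (by omega) (by rwa [ed1, abs_neg])
  have ed2 := centreDev_cons hq (show k + 1 ≤ 2 * k + 1 by omega) (fun i => (hd1 i).1)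
  refine mem_B2_of_admissible (by omega) hq (by push_cast; linarith) hr0 hc4 hd2 ?_
  refine Eq.trans ?_ h
  rw [e4, e3, e2, e1, ec, ed2, ed1, ed]
  push_cast
  generalize 1 / ((q + 1) * (q ^ 2 + 1)) / q ^ (2 * i + 1) = u
  generalize 1 / ((q + 1) * (q ^ 2 + 1)) / q ^ (2 * j + 1) = v
  generalize 1 / (2 * (q + 1)) = p
  field_simp
  ring

theorem tendsto_div_pow_zero {q : ℝ} (hq : 1 < q) (C : ℝ) :
    Filter.Tendsto (fun n : ℕ => C / q ^ n) Filter.atTop (nhds 0) :=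
  Filter.Tendsto.div_atTop tendsto_const_nhds (tendsto_pow_atTop_atTop_of_one_lt hq)

theorem even_mem_accPts_accPts {k : ℕ} (hk : 0 < k) {x : ℝ}
    (h : x ^ 2 - (k + 1) * x - k = 0)
    (hmax : ∀ y : ℝ, y ^ 2 - ((k : ℝ) + 1) * y - k = 0 → y ≤ x) :
    x ∈ accPts (accPts (B2 (2 * k))) := by
  have hk' : (1 : ℝ) ≤ k := by exact_mod_cast hk
  have hx0 : (k + 1 : ℝ) < x := by
    have := hmax (k + 1 - x) (by linear_combination h)
    nlinarith
  have hx2 : x < k + 2 := by nlinarith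
  have hpos : ∀ y ∈ Set.Icc x (k + 2), 1 < y := fun y hy => by linarith [hy.1]
  have hpos0 : ∀ y ∈ Set.Icc x (k + 2), 0 < y := fun y hy => by linarith [hy.1]
  refine mem_accPts_accPts hx2 (G := fun q => (k + 1) / q + k / q ^ 2)
    (e := fun i q => 1 / (q + 1) / q ^ i / q ^ 2) (e' := fun j q => 1 / (q + 1) / q ^ j / q)
    ?_ ?_ ?_ ?_ ?_ ?_ ?_ ?_ ?_ ?_ ?_
  · fun_prop (disch := intro y hy; have := hpos0 y hy; positivity)
  · intro a ha b hb hab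
    have := hpos0 a ha
    simp only
    gcongr
  · have : 0 < x := by linarith
    field_simp
    linarith
  · intro n
    fun_prop (disch := intro y hy; have := hpos0 y hy; positivity)
  · intro n y hy
    have := hpos0 y hy
    positivity
  · intro n a ha b hb hab
    have := hpos0 a ha
    simp only
    gcongr
  · intro y hy
    simpa using (tendsto_div_pow_zero (hpos y hy) (1 / (y + 1))).div_const (y ^ 2)
  · intro n
    fun_prop (disch := intro y hy; have := hpos0 y hy; positivity)
  · intro n y hy
    have := hpos0 y hy
    positivity
  · intro y hy
    simpa using (tendsto_div_pow_zero (hpos y hy) (1 / (y + 1))).div_const y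
  · intro i j q hq hq1
    have hqx := hq.1
    refine even_mem_B2 hk (hpos q ⟨hq.1.le, hq.2.le⟩) hq.2 ?_ hq1
    nlinarith

theorem odd_mem_accPts_accPts {k : ℕ} {x : ℝ}
    (h : x ^ 3 - ((k : ℝ) + 2) * x ^ 2 + x - (k + 1) = 0)
    (hmax : ∀ y : ℝ, y ^ 3 - ((k : ℝ) + 2) * y ^ 2 + y - ((k : ℝ) + 1) = 0 → y ≤ x) :
    x ∈ accPts (accPts (B2 (2 * k + 1))) := by
  have hk' : (0 : ℝ) ≤ k := by positivity
  have hx2 := isQf_le_two_add h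
  have hx0 : (k + 3 / 2 : ℝ) < x := by
    have hc : ContinuousOn (fun y : ℝ => y ^ 3 - ((k : ℝ) + 2) * y ^ 2 + y - (k + 1))
      (Set.Icc (k + 3 / 2 : ℝ) (k + 2)) := by fun_prop
    obtain ⟨y, hy, e⟩ := intermediate_value_Ioo (by linarith) hc
      (show (0 : ℝ) ∈ Set.Ioo _ _ from ⟨by nlinarith, by nlinarith⟩)
    exact hy.1.trans_le (hmax y e)
  have hpos : ∀ y ∈ Set.Icc x (k + 2), 1 < y := fun y hy => by linarith [hy.1]
  have hpos0 : ∀ y ∈ Set.Icc x (k + 2), 0 < y := fun y hy => by linarith [hy.1]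
  have hxp : 0 < x := by linarith
  refine mem_accPts_accPts hx2
    (G := fun q => (k + 1 / 2) / q + (k + 1 / 2) / q ^ 2 + (k + 1 / 2) / q ^ 3 +
      (k + 1 / 2) / q ^ 4 + 1 / (2 * (q + 1)) / q ^ 4 + (1 / 2 + 1 / (2 * (q + 1))) / q)
    (e := fun i q => 1 / ((q + 1) * (q ^ 2 + 1)) / q ^ (2 * i + 1) / q ^ 4)
    (e' := fun j q => 1 / ((q + 1) * (q ^ 2 + 1)) / q ^ (2 * j + 1) / q)
    ?_ ?_ ?_ ?_ ?_ ?_ ?_ ?_ ?_ ?_ ?_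
  · fun_prop (disch := intro y hy; have := hpos0 y hy; positivity)
  · intro a ha b hb hab
    have := hpos0 a ha
    have := hpos0 b hb
    simp only
    gcongr
  · field_simp
    linear_combination (-2) * (x + 1) ^ 2 * h
  · intro n
    fun_prop (disch := intro y hy; have := hpos0 y hy; positivity)
  · intro n y hy
    have := hpos0 y hy
    positivity
  · intro n a ha b hb hab
    have := hpos0 a ha
    have := hpos0 b hb
    simp only
    gcongr
  · intro y hy
    have hlim := (tendsto_div_pow_zero (hpos y hy) (1 / ((y + 1) * (y ^ 2 + 1)))).comp
      (Filter.tendsto_atTop_mono (fun n => show n ≤ 2 * n + 1 by omega) Filter.tendsto_id)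
    simpa using hlim.div_const (y ^ 4)
  · intro n
    fun_prop (disch := intro y hy; have := hpos0 y hy; positivity)
  · intro n y hy
    have := hpos0 y hy
    positivity
  · intro y hy
    have hlim := (tendsto_div_pow_zero (hpos y hy) (1 / ((y + 1) * (y ^ 2 + 1)))).comp
      (Filter.tendsto_atTop_mono (fun n => show n ≤ 2 * n + 1 by omega) Filter.tendsto_id)
    simpa using hlim.div_const y
  · intro i j q hq hq1
    have hqx := hq.1
    refine odd_mem_B2 (hpos q ⟨hq.1.le, hq.2.le⟩) hq.2 ?_ hq1
    have e : q ^ 3 - (k + 2) * q ^ 2 + q - (k + 1) =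
        (q - x) * (q ^ 2 + q * x + x ^ 2 - (k + 2) * (q + x) + 1) := by
      linear_combination h
    rw [e]
    refine mul_pos (by linarith) ?_
    nlinarith

/-- `min B_2^{(1)}(m) = min B_2^{(2)}(m) = q_f(m)`. -/
theorem stmt17 (m : ℕ) (hm : 0 < m) (qf : ℝ) (hqf : isQf m qf) :
    IsLeast (B2iter m 1) qf ∧ IsLeast (B2iter m 2) qf := by
  refine isLeast_of_mem_accPts_accPts (finite_B2_inter_Iio hm hqf) ?_
  rcases hqf with ⟨k, rfl, h, hmax⟩ | ⟨k, rfl, h, hmax⟩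
  · exact odd_mem_accPts_accPts h hmax
  · exact even_mem_accPts_accPts (by omega) h hmax
end

section
/- Let m = 2k be an even positive integer with k ≥ 1, let q ∈ [q_f(m), m+1], and let c = (c_i), d = (d_i) ∈ A'_q. If the sequence (c_i + d_i) is lexicographically at least the sequence k0^∞ (first term k, all other terms 0), then f_{c,d}(q) > 0. -/
theorem Summable.div_pow_of_digits_le {m : ℕ} {q : ℝ} (hq : 1 < q) {c : ℕ → ℕ}
    (hc : ∀ i, c i ≤ m) (j : ℕ) : Summable fun i => (c i : ℝ) / q ^ (i + j) := by
  have hq0 : 0 < q := by linarith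
  have hgeom : Summable fun i : ℕ => (m : ℝ) / q ^ j * q⁻¹ ^ i :=
    (summable_geometric_of_lt_one (by positivity) (inv_lt_one_of_one_lt₀ hq)).mul_left _
  refine Summable.of_nonneg_of_le (fun i => by positivity) (fun i => ?_) hgeom
  have hci : (c i : ℝ) ≤ m := by exact_mod_cast hc i
  calc (c i : ℝ) / q ^ (i + j) ≤ m / q ^ (i + j) := by gcongr
    _ = m / q ^ j * q⁻¹ ^ i := by rw [pow_add, inv_pow]; field_simp

/-- When `1 = (k + 1) / q + k / q ^ 2`, a sequence `j 0^∞` in `U'_q` has `j = 0`, since for `j > 0`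
the value `j / q` also has the expansion `(j - 1) (k + 1) k 0^∞`. -/
theorem head_eq_zero_of_mem_Uq' {k m : ℕ} {q : ℝ} (hkm : k + 1 ≤ m) (hq : 0 < q)
    (hroot : q ^ 2 - ((k : ℝ) + 1) * q - (k : ℝ) = 0) {c : ℕ → ℕ} (hc : c ∈ Uq' m q)
    (htail : ∀ i, i ≠ 0 → c i = 0) : c 0 = 0 := by
  by_contra h0
  obtain ⟨j, hj⟩ := Nat.exists_eq_succ_of_ne_zero h0
  let e : ℕ → ℕ := fun i => if i = 0 then j else if i = 1 then k + 1 else if i = 2 then k else 0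
  have he : e = c := by
    refine hc.2 e ⟨fun i => ?_, ?_⟩
    · have := hc.1.1 0
      simp only [e]
      split_ifs <;> omega
    · rw [tsum_eq_single 0 fun i hi => by simp [htail i hi],
        tsum_eq_sum (s := Finset.range 3) fun i hi => by
          have h3 : 3 ≤ i := by simpa using hi
          have : e i = 0 := by simp only [e]; split_ifs <;> omega
          simp [this]]
      simp only [Finset.sum_range_succ, Finset.sum_range_zero, e, hj]
      push_cast
      norm_num
      field_simp
      linarith
  have := congrFun he 0
  simp only [e, if_true] at this
  omega

/-- For even `m = 2k`, `k ≥ 1`: if `c + d ≥ k0^∞`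
lexicographically, then `f_{c,d}(q) > 0` for all `q ∈ [q_f(m), m+1]`. -/
theorem stmt18 (k m : ℕ) (hk : 1 ≤ k) (hm : m = 2 * k) (qf : ℝ)
    (hqf : qf ^ 2 - ((k : ℝ) + 1) * qf - (k : ℝ) = 0)
    (hqf' : ∀ y : ℝ, y ^ 2 - ((k : ℝ) + 1) * y - (k : ℝ) = 0 → y ≤ qf)
    (q : ℝ) (hq : q ∈ Set.Icc qf ((m : ℝ) + 1))
    (c d : ℕ → ℕ) (hc : c ∈ Aq' m q) (hd : d ∈ Aq' m q)
    (hge : lexLe (fun i => if i = 0 then k else 0) (fun i => c i + d i)) :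
    0 < fcd m c d q := by
  have hk1 : (1 : ℝ) ≤ k := by exact_mod_cast hk
  have hconj : (k : ℝ) + 1 - qf ≤ qf := hqf' _ (by linear_combination hqf)
  have hqf1 : (k : ℝ) + 1 < qf := by
    by_contra! h
    nlinarith
  obtain ⟨hqq, -⟩ := hq
  have hq1 : 1 < q := by linarith
  have hq0 : 0 < q := by linarith
  have hsum : Summable fun i : ℕ => ((c i : ℝ) + (d i : ℝ)) / q ^ (i + 2) := by
    simpa only [add_div] using (Summable.div_pow_of_digits_le hq1 hc.1.1.1 2).add
      (Summable.div_pow_of_digits_le hq1 hd.1.1.1 2)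
  have hhead : k ≤ c 0 + d 0 := by
    rcases hge with ⟨n, heq, hlt⟩ | heq
    · rcases Nat.eq_zero_or_pos n with rfl | hn
      · simpa using hlt.le
      · simpa using (heq 0 hn).le
    · simpa using (congrFun heq 0).le
  have hsingle : ∑' i : ℕ, (if i = 0 then (k : ℝ) else 0) / q ^ (i + 2) = k / q ^ 2 := by
    rw [tsum_eq_single 0 fun i hi => by simp [hi]]
    simp
  have hsummable : Summable fun i : ℕ => (if i = 0 then (k : ℝ) else 0) / q ^ (i + 2) :=
    summable_of_ne_finset_zero (s := {0}) fun i hi => by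
      have : i ≠ 0 := by simpa using hi
      simp [this]
  have hdigit : ∀ i, (if i = 0 then (k : ℝ) else 0) ≤ (c i : ℝ) + d i := by
    intro i
    split_ifs with hi
    · subst hi
      exact_mod_cast hhead
    · positivity
  have hterm : ∀ i : ℕ, (if i = 0 then (k : ℝ) else 0) / q ^ (i + 2)
      ≤ ((c i : ℝ) + d i) / q ^ (i + 2) := fun i => by
    have := hdigit i
    gcongr
  have hpoly : ((m : ℝ) + 1) / q + k / q ^ 2 - m / (q - 1)
      = (q ^ 2 - (k + 1) * q - k) / (q ^ 2 * (q - 1)) := by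
    have : q - 1 ≠ 0 := by linarith
    rw [hm]
    push_cast
    field_simp
    ring
  have hden : 0 < q ^ 2 * (q - 1) := mul_pos (by positivity) (by linarith)
  unfold fcd
  rcases hqq.lt_or_eq with hlt | rfl
  · have hle := hsummable.tsum_le_tsum hterm hsum
    rw [hsingle] at hle
    have hpos : 0 < (q ^ 2 - (k + 1) * q - k) / (q ^ 2 * (q - 1)) :=
      div_pos (by nlinarith) hden
    linarith
  · have hstrict : ∃ i, (if i = 0 then (k : ℝ) else 0) < (c i : ℝ) + d i := by
      by_contra! h
      have htail : ∀ i, i ≠ 0 → c i + d i = 0 := fun i hi => by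
        have := h i
        rw [if_neg hi] at this
        exact Nat.le_zero.mp (by exact_mod_cast this)
      have hc0 := head_eq_zero_of_mem_Uq' (by omega) hq0 hqf hc.1
        fun i hi => by have := htail i hi; omega
      have hd0 := head_eq_zero_of_mem_Uq' (by omega) hq0 hqf hd.1
        fun i hi => by have := htail i hi; omega
      omega
    obtain ⟨i, hi⟩ := hstrict
    have hlt := Summable.tsum_lt_tsum hterm (by gcongr) hsummable hsum (i := i)
    rw [hsingle] at hlt
    rw [hqf, zero_div] at hpoly
    linarith
end
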